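/- arXiv:2002.02736 — 4 statements merged into one kernel-verified Lean document; each statement's English description precedes it below -/
import Mathlib

section
/- The Serre derivative ∂_{w−r} maps quasimodular forms of weight w and depth ≤ r to quasimodular forms of weight w+2 and depth ≤ r; that is, if f ∈ QM_w^r then ∂_{w−r} f ∈ QM_{w+2}^r. -/
open Complex UpperHalfPlane Finset
open scoped Manifold MatrixGroups Real

noncomputable section

/-- The nome `q = e^{2πiz}`. -/
def qexp (z : ℍ) : ℂ := Complex.exp (2 * Real.pi * Complex.I * z)

/-- The normalized Eisenstein series `E_k` (for even `k ≥ 2`), defined via its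
`q`-expansion `E_k = 1 - (2k/B_k) ∑_{n ≥ 1} σ_{k-1}(n) q^n`. -/
def Eis (k : ℕ) (z : ℍ) : ℂ :=
  1 - (2 * k / ((bernoulli k : ℚ) : ℂ)) *
    ∑' n : ℕ, (ArithmeticFunction.sigma (k - 1) (n + 1) : ℂ) * qexp z ^ (n + 1)

/-- The modular discriminant `Δ = (E_4³ − E_6²)/1728`. -/
def Disc (z : ℍ) : ℂ := (Eis 4 z ^ 3 - Eis 6 z ^ 2) / 1728

/-- The space of holomorphic modular forms of weight `w` for the full modular group,
as a set of functions on `ℍ`. -/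
def Mset (w : ℤ) : Set (ℍ → ℂ) :=
  {f | ∃ F : ModularForm (⊤ : Subgroup SL(2, ℤ)) w, ⇑F = f}

/-- The set of quasimodular forms of weight `w` and depth `≤ r`:
functions of the form `∑_{ℓ=0}^r E_2^ℓ h_ℓ` with `h_ℓ ∈ M_{w-2ℓ}`. -/
def QMset (w : ℤ) (r : ℕ) : Set (ℍ → ℂ) :=
  {f | ∃ h : ℕ → ℍ → ℂ, (∀ ℓ ≤ r, h ℓ ∈ Mset (w - 2 * ℓ)) ∧
        ∀ z, f z = ∑ ℓ ∈ Finset.range (r + 1), Eis 2 z ^ ℓ * h ℓ z}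

/-- `QM_w^r` as a `ℂ`-subspace of the functions on `ℍ`. -/
def QM (w : ℤ) (r : ℕ) : Submodule ℂ (ℍ → ℂ) := Submodule.span ℂ (QMset w r)

/-- `dim QM_w^r`. -/
def dimQM (w : ℤ) (r : ℕ) : ℕ := Module.finrank ℂ (QM w r)

/-- The complex derivative of a function on `ℍ` (via an extension to `ℂ`; since `ℍ` is
open in `ℂ` this agrees with the complex derivative for holomorphic `f`). -/
def hderiv (f : ℍ → ℂ) (z : ℍ) : ℂ :=
  deriv (fun w : ℂ => if h : 0 < w.im then f ⟨w, h⟩ else 0) z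

/-- The normalized derivative `f' = (2πi)⁻¹ df/dz = q df/dq`. -/
def qderiv (f : ℍ → ℂ) (z : ℍ) : ℂ := (2 * Real.pi * Complex.I)⁻¹ * hderiv f z

/-- The Serre derivative `∂_w f = f' - (w/12) E_2 f`. -/
def serre (w : ℤ) (f : ℍ → ℂ) (z : ℍ) : ℂ :=
  qderiv f z - ((w : ℂ) / 12) * Eis 2 z * f z

/-- Iterated Serre derivatives: `∂_w^0 f = f`, `∂_w^{k+1} f = ∂_{w+2k}(∂_w^k f)`. -/
def serreIter (w : ℤ) : ℕ → (ℍ → ℂ) → (ℍ → ℂ)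
  | 0, f => f
  | (k + 1), f => serre (w + 2 * k) (serreIter w k f)

/-- `z ↦ -1/z` as a map `ℍ → ℍ`. -/
def Sact (z : ℍ) : ℍ :=
  ⟨-(z : ℂ)⁻¹, by
    have h0 : (z : ℂ) ≠ 0 := z.ne_zero
    have : (-(z : ℂ)⁻¹).im = (z : ℂ).im / Complex.normSq (z : ℂ) := by
      rw [Complex.neg_im, Complex.inv_im]; ring
    rw [this]
    exact div_pos z.im_pos (Complex.normSq_pos.mpr h0)⟩

/-- `z ↦ z + 1` as a map `ℍ → ℍ`. -/
def Tact (z : ℍ) : ℍ := ⟨(z : ℂ) + 1, by simpa using z.im_pos⟩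

/-- `g` has a `q`-expansion with vanishing order exactly `ν` at `i∞`:
`g = q^ν ∑_{n≥0} a(n) qⁿ` with `a(0) ≠ 0`. -/
def HasQExpansionAt (g : ℍ → ℂ) (ν : ℕ) : Prop :=
  ∃ a : ℕ → ℂ, a 0 ≠ 0 ∧ ∀ z : ℍ, HasSum (fun n : ℕ => a n * qexp z ^ (ν + n)) (g z)

/-- The quasimodular forms `g_ℓ` attached to `f = ∑_{ℓ=0}^r E_2^ℓ h_ℓ`, defined by
`C(r,ℓ) g_ℓ = (6/(πi))^ℓ ∑_{m=0}^{r-ℓ} C(ℓ+m,m) E_2^m h_{ℓ+m}`. -/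
def gOf (r : ℕ) (h : ℕ → ℍ → ℂ) (ℓ : ℕ) (z : ℍ) : ℂ :=
  ((r.choose ℓ : ℂ))⁻¹ * (6 / ((Real.pi : ℂ) * Complex.I)) ^ ℓ *
    ∑ m ∈ Finset.range (r - ℓ + 1), (((ℓ + m).choose m : ℕ) : ℂ) * Eis 2 z ^ m * h (ℓ + m) z

/-- `f` is a balanced quasimodular form of weight `w` and depth `r`. -/
def IsBalancedQM (w : ℤ) (r : ℕ) (f : ℍ → ℂ) : Prop :=
  ∃ h : ℕ → ℍ → ℂ, ∃ lam : ℕ → ℕ,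
    (∀ ℓ ≤ r, h ℓ ∈ Mset (w - 2 * ℓ)) ∧ h r ≠ 0 ∧
    (∀ z, f z = ∑ ℓ ∈ Finset.range (r + 1), Eis 2 z ^ ℓ * h ℓ z) ∧
    (∀ ℓ ≤ r, HasQExpansionAt (gOf r h ℓ) (lam ℓ)) ∧
    (∀ i j, i ≤ j → j ≤ r → lam j ≤ lam i) ∧
    (∀ ℓ ≤ r, lam ℓ < dimQM (w - 2 * ℓ) (r - ℓ)) ∧
    (∑ ℓ ∈ Finset.range (r + 1), lam ℓ) = dimQM w r - 1

/-- `f` is the normalized extremal quasimodular form of weight `w` and depth `r`: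
`f ∈ QM_w^r` with `q`-expansion `q^{dim QM_w^r - 1}(1 + O(q))`. -/
def IsNormalizedExtremalQM (w : ℤ) (r : ℕ) (f : ℍ → ℂ) : Prop :=
  f ∈ QM w r ∧ ∃ a : ℕ → ℂ, a 0 = 1 ∧
    ∀ z : ℍ, HasSum (fun n : ℕ => a n * qexp z ^ (dimQM w r - 1 + n)) (f z)

/-- `f 0, …, f (n-1)` is a fundamental system of solutions of the linear differential
equation `K g = 0`: holomorphic linearly independent solutions spanning all
holomorphic solutions. -/
def IsFundamentalSystem {n : ℕ} (K : (ℍ → ℂ) → (ℍ → ℂ)) (f : Fin n → ℍ → ℂ) : Prop :=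
  (∀ i, MDifferentiable 𝓘(ℂ) 𝓘(ℂ) (f i)) ∧ (∀ i, K (f i) = 0) ∧
    LinearIndependent ℂ f ∧
    ∀ g : ℍ → ℂ, MDifferentiable 𝓘(ℂ) 𝓘(ℂ) g → K g = 0 → g ∈ Submodule.span ℂ (Set.range f)


/-- `F = (f_0, …, f_r)ᵀ` is a quasimodular vector of weight `w` and dimension `r+1`:
all components are holomorphic and there is a quasimodular form `f = ∑_{ℓ=0}^s E_2^ℓ h_ℓ`
of weight `w` and depth `s ≤ r` such that
`f_k(z) = ∑_{ℓ=0}^{min(k,s)} C(k,ℓ) z^{k-ℓ} g_ℓ(z)` for the attached forms `g_ℓ`. -/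
def IsQuasimodularVector (w : ℤ) (r : ℕ) (F : Fin (r + 1) → ℍ → ℂ) : Prop :=
  (∀ k, MDifferentiable 𝓘(ℂ) 𝓘(ℂ) (F k)) ∧
  ∃ s : ℕ, s ≤ r ∧ ∃ h : ℕ → ℍ → ℂ,
    (∀ ℓ ≤ s, h ℓ ∈ Mset (w - 2 * ℓ)) ∧ (s = 0 ∨ h s ≠ 0) ∧
    ∀ (k : Fin (r + 1)) (z : ℍ),
      F k z = ∑ ℓ ∈ Finset.range (min (k : ℕ) s + 1),
        (((k : ℕ).choose ℓ : ℕ) : ℂ) * (z : ℂ) ^ ((k : ℕ) - ℓ) * gOf s h ℓ z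

/-- The modular Wronskian `W(z) = det(F, ∂_{w-r}F, …, ∂_{w-r}^r F)`. -/
def modularWronskian (w : ℤ) (r : ℕ) (F : Fin (r + 1) → ℍ → ℂ) (z : ℍ) : ℂ :=
  Matrix.det (Matrix.of fun (k j : Fin (r + 1)) => serreIter (w - r) (j : ℕ) (F k) z)

end

open Derivative EisensteinSeries
open scoped ModularForm

theorem mem_Mset_iff {k : ℤ} {f : ℍ → ℂ} :
    f ∈ Mset k ↔ (∀ γ : SL(2, ℤ), f ∣[k] γ = f) ∧ MDiff f ∧ IsBoundedAtImInfty f := by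
  have hΓ : (((⊤ : Subgroup SL(2, ℤ)) : Subgroup (GL (Fin 2) ℝ))) = 𝒮ℒ :=
    (MonoidHom.range_eq_map _).symm
  constructor
  · rintro ⟨F, rfl⟩
    refine ⟨fun γ => F.slash_action_eq' _ ⟨γ, trivial, rfl⟩, F.holo', ?_⟩
    refine OnePoint.isBoundedAt_infty_iff.mp (F.bdd_at_cusps' ?_)
    rw [hΓ]
    exact isCusp_SL2Z_iff'.mpr ⟨1, by simp⟩
  · rintro ⟨hslash, hdiff, hbdd⟩
    refine ⟨{ toFun := f, slash_action_eq' := ?_, holo' := hdiff, bdd_at_cusps' := ?_ }, rfl⟩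
    · rintro _ ⟨γ, -, rfl⟩
      exact hslash γ
    · intro c hc
      rw [hΓ] at hc
      rw [OnePoint.isBoundedAt_iff_forall_SL2Z hc]
      intro γ _
      rwa [hslash γ]

theorem Mset.mul {k l m : ℤ} {f g : ℍ → ℂ} (hf : f ∈ Mset k) (hg : g ∈ Mset l)
    (h : k + l = m) : f * g ∈ Mset m := by
  subst h
  rw [mem_Mset_iff] at *
  exact ⟨fun γ => by rw [ModularForm.mul_slash_SL2, hf.1, hg.1], hf.2.1.mul hg.2.1,
    hf.2.2.mul hg.2.2⟩

theorem zero_mem_Mset (k : ℤ) : (0 : ℍ → ℂ) ∈ Mset k := ⟨0, rfl⟩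

theorem Eis_two_eq_E2 : Eis 2 = E2 := by
  ext z
  rw [E2_eq_tsum_cexp,
    tsum_pnat_eq_tsum_succ (f := fun n ↦ (ArithmeticFunction.sigma 1 n : ℂ) *
      cexp (2 * π * Complex.I * z) ^ n)]
  simp only [Eis, qexp, bernoulli_two]
  norm_num

theorem qderiv_eq_normalizedDeriv (f : ℍ → ℂ) :
    qderiv f = normalizedDerivOfComplex f := by
  ext z
  unfold qderiv hderiv normalizedDerivOfComplex
  congr 1
  apply Filter.EventuallyEq.deriv_eq
  filter_upwards [isOpen_upperHalfPlaneSet.mem_nhds z.im_pos] with w hw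
  have hw' : 0 < w.im := hw
  simp [hw', ofComplex_apply_of_im_pos hw']

theorem serre_eq_serreDerivative (k : ℤ) (f : ℍ → ℂ) :
    serre k f = serreDerivative k f := by
  ext z
  simp [serre, qderiv_eq_normalizedDeriv, Eis_two_eq_E2, div_eq_mul_inv]

theorem isBoundedAtImInfty_normalizedDeriv {f : ℍ → ℂ} (hf : MDiff f)
    (hb : IsBoundedAtImInfty f) : IsBoundedAtImInfty (normalizedDerivOfComplex f) := by
  obtain ⟨M, A, hMA⟩ := isBoundedAtImInfty_iff.mp hb
  refine isBoundedAtImInfty_iff.mpr ⟨‖(2 * π * Complex.I)⁻¹‖ * M, max A 0 + 2, fun z hz => ?_⟩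
  have him : ∀ w ∈ Metric.closedBall (z : ℂ) 1, max A 0 < w.im := by
    intro w hw
    have h1 := (abs_le.mp ((abs_im_le_norm (w - z)).trans (mem_closedBall_iff_norm.mp hw))).1
    rw [sub_im] at h1
    have h2 : (z : ℂ).im = z.im := rfl
    linarith
  rw [normalizedDerivOfComplex, norm_mul]
  gcongr
  have hd : DiffContOnCl ℂ (f ∘ ofComplex) (Metric.ball (z : ℂ) 1) := by
    apply DifferentiableOn.diffContOnCl
    rw [closure_ball _ one_ne_zero]
    exact (UpperHalfPlane.mdifferentiable_iff.mp hf).mono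
      fun w hw => (le_max_right A 0).trans_lt (him w hw)
  refine (norm_deriv_le_of_forall_mem_sphere_norm_le one_pos hd fun w hw => ?_).trans_eq
    (div_one M)
  have hw' := him w (Metric.sphere_subset_closedBall hw)
  have hpos : 0 < w.im := (le_max_right A 0).trans_lt hw'
  rw [Function.comp_apply, ofComplex_apply_of_im_pos hpos]
  exact hMA _ ((le_max_left A 0).trans hw'.le)

theorem isBoundedAtImInfty_serreDerivative (k : ℂ) {f : ℍ → ℂ} (hf : MDiff f)
    (hb : IsBoundedAtImInfty f) : IsBoundedAtImInfty (serreDerivative k f) := by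
  have h : serreDerivative k f =
      normalizedDerivOfComplex f + (-(k * 12⁻¹)) • (E2 * f) := by
    ext z
    simp
    ring
  rw [h]
  exact (isBoundedAtImInfty_normalizedDeriv hf hb).add
    ((isBoundedAtImInfty_E2.mul hb).smul _)

theorem serreDerivative_mem_Mset {k : ℤ} {f : ℍ → ℂ} (hf : f ∈ Mset k) :
    serreDerivative k f ∈ Mset (k + 2) := by
  rw [mem_Mset_iff] at *
  exact ⟨fun γ => serreDerivative_slash_invariant hf.2.1 (hf.1 γ),
    serreDerivative_mdifferentiable _ hf.2.1,
    isBoundedAtImInfty_serreDerivative _ hf.2.1 hf.2.2⟩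

theorem hasDerivAt_D2 (γ : SL(2, ℤ)) (z : ℍ) :
    HasDerivAt (D2 γ ∘ ofComplex) (-(2 * π * Complex.I) * (γ 1 0 / denom γ z) ^ 2) z := by
  have h := (hasDerivAt_denom_zpow (γ : GL (Fin 2) ℝ) (-1) z).const_mul
    (2 * π * Complex.I * γ 1 0)
  have heq : D2 γ ∘ ofComplex =ᶠ[nhds (z : ℂ)]
      fun w => 2 * π * Complex.I * γ 1 0 * denom (γ : GL (Fin 2) ℝ) w ^ (-1 : ℤ) := by
    filter_upwards [isOpen_upperHalfPlaneSet.mem_nhds z.im_pos] with w hw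
    simp [D2, ofComplex_apply_of_im_pos hw, div_eq_mul_inv]
  refine (h.congr_of_eventuallyEq heq).congr_deriv ?_
  simp [zpow_neg, div_eq_mul_inv]
  norm_cast
  ring

theorem mdifferentiable_D2 (γ : SL(2, ℤ)) : MDiff (D2 γ) := fun z =>
  UpperHalfPlane.mdifferentiableAt_iff.mpr (hasDerivAt_D2 γ z).differentiableAt

theorem normalizedDeriv_D2 (γ : SL(2, ℤ)) (z : ℍ) :
    normalizedDerivOfComplex (D2 γ) z = (2 * riemannZeta 2)⁻¹ * D2 γ z ^ 2 / 12 := by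
  have hpi : (π : ℂ) ≠ 0 := by exact_mod_cast Real.pi_ne_zero
  have hden := denom_ne_zero (γ : GL (Fin 2) ℝ) z
  rw [normalizedDerivOfComplex, (hasDerivAt_D2 γ z).deriv, D2, riemannZeta_two]
  field_simp
  rw [I_sq]
  ring

/-- The weight four modular form `∂₁E₂ = E₂' - E₂²/12` (equal to `-E₄/12`). -/
theorem serreDerivative_one_E2_mem_Mset : serreDerivative 1 E2 ∈ Mset 4 := by
  have hsq : serreDerivative 1 E2 = serreDerivative (2 : ℤ) E2 + (12⁻¹ : ℂ) • (E2 * E2) := by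
    ext z
    simp
    ring
  refine mem_Mset_iff.mpr ⟨fun γ => ?_, serreDerivative_mdifferentiable _ E2_mdifferentiable,
    isBoundedAtImInfty_serreDerivative _ E2_mdifferentiable isBoundedAtImInfty_E2⟩
  have hS := serreDerivative_slash_equivariant (k := 2) E2_mdifferentiable (γ := γ)
  have hM := ModularForm.mul_slash_SL2 2 2 γ E2 E2
  rw [show (2 : ℤ) + 2 = 4 from rfl] at hS hM
  have hD : MDiff ((1 / (2 * riemannZeta 2)) • D2 γ) := (mdifferentiable_D2 γ).const_smul _
  rw [hsq, SlashAction.add_slash, ModularForm.SL_smul_slash, hS, hM, E2_slash_action,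
    serreDerivative_sub _ _ _ E2_mdifferentiable hD,
    serreDerivative_smul _ _ _ (mdifferentiable_D2 γ)]
  ext z
  simp [normalizedDeriv_D2]
  ring

theorem E2_pow_mul_mem_QM {w k : ℤ} {r l : ℕ} (hl : l ≤ r) {f : ℍ → ℂ} (hf : f ∈ Mset k)
    (hk : k = w - 2 * l) : E2 ^ l * f ∈ QM w r := by
  classical
  subst hk
  refine Submodule.subset_span ⟨Pi.single l f, fun m _ => ?_, fun z => ?_⟩
  · rcases eq_or_ne m l with rfl | hm
    · simpa using hf
    · simpa [hm] using zero_mem_Mset _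
  · rw [Finset.sum_eq_single l]
    · simp [Eis_two_eq_E2]
    · intro m _ hm
      simp [hm]
    · intro h
      exact absurd (Finset.mem_range.mpr (by omega)) h

theorem serreDerivative_E2_pow_mul (w : ℤ) (r l : ℕ) {f : ℍ → ℂ} (hf : MDiff f) :
    serreDerivative (w - r : ℤ) (E2 ^ l * f) =
      (l : ℂ) • (E2 ^ (l - 1) * (serreDerivative 1 E2 * f)) +
      (E2 ^ l * serreDerivative (w - 2 * l : ℤ) f +
      (((r : ℂ) - l) / 12) • (E2 ^ (l + 1) * f)) := by
  have hE := E2_mdifferentiable.pow l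
  ext z
  cases l with
  | zero =>
    simp
    ring
  | succ n =>
    simp [normalizedDerivOfComplex_mul _ _ hE hf,
      normalizedDerivOfComplex_pow _ _ E2_mdifferentiable]
    ring

theorem serreDerivative_E2_pow_mul_mem_QM {w : ℤ} {r l : ℕ} (hl : l ≤ r) {f : ℍ → ℂ}
    (hf : f ∈ Mset (w - 2 * l)) :
    serreDerivative (w - r : ℤ) (E2 ^ l * f) ∈ QM (w + 2) r := by
  rw [serreDerivative_E2_pow_mul w r l (mem_Mset_iff.mp hf).2.1]
  refine add_mem ?_ (add_mem ?_ ?_)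
  · cases l with
    | zero => simp
    | succ n =>
      exact Submodule.smul_mem _ _ (E2_pow_mul_mem_QM (by omega)
        (Mset.mul serreDerivative_one_E2_mem_Mset hf rfl) (by push_cast; ring))
  · exact E2_pow_mul_mem_QM hl (serreDerivative_mem_Mset hf) (by ring)
  · rcases hl.eq_or_lt with rfl | hlt
    · simp
    · exact Submodule.smul_mem _ _ (E2_pow_mul_mem_QM hlt hf (by push_cast; ring))

/-- Lemma 1 of the paper: the Serre derivative `∂_{w-r}` maps
quasimodular forms of weight `w` and depth `≤ r` to quasimodular forms of weight
`w + 2` and depth `≤ r`. -/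
theorem serre_maps_quasimodular (w : ℤ) (r : ℕ) (f : ℍ → ℂ) (hf : f ∈ QM w r) :
    (fun z : ℍ => serre (w - r) f z) ∈ QM (w + 2) r := by
  change serre (w - r) f ∈ QM (w + 2) r
  rw [serre_eq_serreDerivative]
  suffices h : MDiff f ∧ serreDerivative (w - r : ℤ) f ∈ QM (w + 2) r from h.2
  have hzero : serreDerivative (w - r : ℤ) 0 = 0 := by
    simpa using serreDerivative_smul (w - r : ℤ) 0 0 (mdifferentiable_const (c := (0 : ℂ)))
  induction hf using Submodule.span_induction with
  | zero => exact ⟨mdifferentiable_const, hzero.symm ▸ zero_mem _⟩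
  | add g h _ _ hg hh =>
    exact ⟨hg.1.add hh.1, serreDerivative_add _ g h hg.1 hh.1 ▸ add_mem hg.2 hh.2⟩
  | smul c g _ hg =>
    exact ⟨hg.1.const_smul c, serreDerivative_smul _ c g hg.1 ▸ Submodule.smul_mem _ c hg.2⟩
  | mem g hg =>
    obtain ⟨h, hh, hg⟩ := hg
    have hsum : g = ∑ l ∈ Finset.range (r + 1), E2 ^ l * h l := by
      ext z
      simp [hg, Eis_two_eq_E2]
    rw [hsum]
    refine Finset.sum_induction _
      (fun F : ℍ → ℂ => MDiff F ∧ serreDerivative (w - r : ℤ) F ∈ QM (w + 2) r) ?_ ?_ ?_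
    · exact fun F G hF hG =>
        ⟨hF.1.add hG.1, serreDerivative_add _ F G hF.1 hG.1 ▸ add_mem hF.2 hG.2⟩
    · exact ⟨mdifferentiable_const, hzero.symm ▸ zero_mem _⟩
    · intro l hl
      have hlr : l ≤ r := by simpa [Nat.lt_succ_iff] using hl
      exact ⟨(E2_mdifferentiable.pow l).mul (mem_Mset_iff.mp (hh l hlr)).2.1,
        serreDerivative_E2_pow_mul_mem_QM hlr (hh l hlr)⟩
end

section
/- Let f : ℍ → ℂ be holomorphic and w ∈ ℤ. Then ∂_w(z^{−w} f(−1/z)) = z^{−w−2} (∂_w f)(−1/z) for all z ∈ ℍ. -/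
open Complex UpperHalfPlane Finset
open scoped Manifold MatrixGroups Real

open scoped ModularForm

/-- The weight-two series given by its `q`-expansion is Mathlib's `E2`. -/
lemma Eis_two_eq_E2_s2 (z : ℍ) : Eis 2 z = EisensteinSeries.E2 z := by
  rw [EisensteinSeries.E2_eq_tsum_cexp, Eis, tsum_pnat_eq_tsum_succ
    (f := fun n ↦ (ArithmeticFunction.sigma 1 n : ℂ) * cexp (2 * π * Complex.I * z) ^ n)]
  norm_num [bernoulli_two, qexp]

lemma qderiv_eq_normalizedDerivOfComplex (f : ℍ → ℂ) (z : ℍ) :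
    qderiv f z = Derivative.normalizedDerivOfComplex f z := by
  rw [qderiv, hderiv, Derivative.normalizedDerivOfComplex]
  congr 1
  apply Filter.EventuallyEq.deriv_eq
  filter_upwards [isOpen_upperHalfPlaneSet.mem_nhds z.im_pos] with x hx
  have hx' : 0 < x.im := hx
  simp [hx', ofComplex_apply_of_im_pos hx']

lemma serre_eq_serreDerivative_s2 (w : ℤ) (f : ℍ → ℂ) (z : ℍ) :
    serre w f z = Derivative.serreDerivative w f z := by
  rw [serre, Eis_two_eq_E2_s2, qderiv_eq_normalizedDerivOfComplex,
    Derivative.serreDerivative_apply, div_eq_mul_inv]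

lemma slash_S_apply_eq_Sact (w : ℤ) (f : ℍ → ℂ) (z : ℍ) :
    (f ∣[w] ModularGroup.S) z = (z : ℂ) ^ (-w) * f (Sact z) := by
  rw [SlashInvariantForm.slash_S_apply, mul_comm]
  congr 2
  ext
  simp [Sact, inv_neg]

/-- Lemma 2 of the paper: for holomorphic `f : ℍ → ℂ` and `w : ℤ`,
`∂_w (z^{-w} f(-1/z)) = z^{-w-2} (∂_w f)(-1/z)`. -/
theorem serre_of_S_slash (w : ℤ) (f : ℍ → ℂ) (hf : MDifferentiable 𝓘(ℂ) 𝓘(ℂ) f) (z : ℍ) :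
    serre w (fun t : ℍ => (t : ℂ) ^ (-w) * f (Sact t)) z
      = (z : ℂ) ^ (-w - 2) * serre w f (Sact z) := by
  have h := congrFun (Derivative.serreDerivative_slash_equivariant (k := w) hf
    (γ := ModularGroup.S)) z
  rw [slash_S_apply_eq_Sact, funext (slash_S_apply_eq_Sact w f)] at h
  rw [serre_eq_serreDerivative_s2, serre_eq_serreDerivative_s2, ← h, neg_add']
end

section
/- Let f_0, f_1, …, f_r be a fundamental system of solutions of the normalized modular differential equation ∂_{w−r}^{r+1} f + B_4 ∂_{w−r}^{r−1} f + … + B_{2r+2} f = 0, where B_4, B_6, …, B_{2r+2} are holomorphic modular forms for Γ of respective weights 4, 6, …, 2r+2. Assume that all solutions λ_0 ≥ λ_1 ≥ … ≥ λ_r ≥ 0 of the indicial equation are integers. Then the modular Wronskian det(F, ∂_{w−r}F, …, ∂_{w−r}^r F) of F = (f_0,…,f_r)^T equals c·Δ^{w(r+1)/12} for some constant c ≠ 0. -/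
open Complex UpperHalfPlane Finset
open scoped Manifold MatrixGroups Real

namespace Wronskian

open Derivative Topology

/-- **Liouville's formula**: if the rows of `M` solve the linear system `y' = y A`, then
`(det M)' = tr A · det M`. -/
lemma hasDerivAt_det_of_linear_system {n : Type*} [Fintype n] [DecidableEq n]
    {M : ℂ → Matrix n n ℂ} {A : Matrix n n ℂ} {z : ℂ}
    (h : ∀ k j, HasDerivAt (fun t ↦ M t k j) (∑ i, A i j * M z k i) z) :
    HasDerivAt (fun t ↦ (M t).det) (A.trace * (M z).det) z := by
  have key : A.trace * (M z).det =
      ∑ j, ((M z).updateCol j fun k ↦ ∑ i, A i j • M z k i).det := by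
    rw [Matrix.trace, Finset.sum_mul]
    exact Finset.sum_congr rfl fun j _ ↦ (Matrix.det_updateCol_sum (M z) j (A · j)).symm
  rw [key]
  simp_rw [Matrix.det_apply]
  rw [Finset.sum_comm]
  refine HasDerivAt.fun_sum fun σ _ ↦ ?_
  rw [← Finset.smul_sum]
  refine HasDerivAt.fun_const_smul _ ?_
  convert! HasDerivAt.fun_finsetProd (u := Finset.univ) (fun i _ ↦ h (σ i) i) using 1
  refine Finset.sum_congr rfl fun j _ ↦ ?_
  rw [← Finset.prod_erase_mul _ _ (Finset.mem_univ j), smul_eq_mul]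
  congr 1
  · refine Finset.prod_congr rfl fun i hi ↦ ?_
    rw [Matrix.updateCol_ne (Finset.ne_of_mem_erase hi)]
  · simp [Matrix.updateCol_self]

/-- An analytic solution of a linear system with analytic coefficients that vanishes at a point
vanishes near that point. -/
lemma eventually_eq_zero_of_linear_system {n : Type*} [Fintype n]
    {v : n → ℂ → ℂ} {A : n → n → ℂ → ℂ} {z₀ : ℂ}
    (hv : ∀ j, AnalyticAt ℂ (v j) z₀) (hA : ∀ i j, AnalyticAt ℂ (A i j) z₀)
    (h : ∀ j, deriv (v j) =ᶠ[𝓝 z₀] ∑ i, A i j * v i) (h₀ : ∀ j, v j z₀ = 0) (j : n) :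
    ∀ᶠ z in 𝓝 z₀, v j z = 0 := by
  have main : ∀ m : ℕ, ∀ j, (m : ℕ∞) ≤ analyticOrderAt (v j) z₀ := by
    intro m
    induction m with
    | zero => simp
    | succ m ih =>
      intro j
      push_cast
      rw [← analyticOrderAt_deriv_ge_iff (hv j) (h₀ j), analyticOrderAt_congr (h j)]
      refine Finset.sum_induction _ (fun g ↦ (m : ℕ∞) ≤ analyticOrderAt g z₀)
        (fun a b ha hb ↦ (le_min ha hb).trans le_analyticOrderAt_add) ?_ fun i _ ↦ ?_
      · rw [analyticOrderAt_eq_top.mpr (by simp)]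
        exact le_top
      · rw [analyticOrderAt_mul (hA i j) (hv i)]
        exact (ih i).trans le_add_self
  rw [← analyticOrderAt_eq_top, ENat.eq_top_iff_forall_ge]
  exact fun m ↦ main m j

lemma comp_ofComplex_eventuallyEq (f : ℍ → ℂ) (z : ℍ) :
    (fun w : ℂ ↦ if h : 0 < w.im then f ⟨w, h⟩ else 0) =ᶠ[𝓝 (z : ℂ)] f ∘ ofComplex := by
  filter_upwards [isOpen_upperHalfPlaneSet.mem_nhds z.im_pos] with w hw
  have hw : 0 < w.im := hw
  simp [hw, ofComplex_apply_of_im_pos hw]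

lemma qderiv_eq (f : ℍ → ℂ) : qderiv f = D f := by
  ext z
  rw [qderiv, hderiv, (comp_ofComplex_eventuallyEq f z).deriv_eq, normalizedDerivOfComplex]

lemma Eis_two : Eis 2 = EisensteinSeries.E2 := by
  ext z
  rw [EisensteinSeries.E2_eq_tsum_cexp, Eis, tsum_pnat_eq_tsum_succ
    (f := fun n ↦ (ArithmeticFunction.sigma 1 n : ℂ) * cexp (2 * π * Complex.I * z) ^ n)]
  norm_num [qexp, bernoulli_two]

lemma Eis_eq_E {k : ℕ} (hk : 3 ≤ k) (hk2 : Even k) : Eis k = ModularForm.E hk := by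
  ext z
  rw [EisensteinSeries.q_expansion_bernoulli hk hk2, Eis]
  simp_rw [zpow_natCast]
  rw [tsum_pnat_eq_tsum_succ
    (f := fun n ↦ (ArithmeticFunction.sigma (k - 1) n : ℂ) * cexp (2 * π * Complex.I * z) ^ n)]
  simp [qexp]

lemma Disc_eq : Disc = ModularForm.discriminant := by
  ext z
  rw [ModularForm.discriminant_eq_E₄_cube_sub_E₆_sq, Disc, Eis_eq_E (by norm_num) ⟨2, rfl⟩,
    Eis_eq_E (by norm_num) ⟨3, rfl⟩]

lemma serre_eq (w : ℤ) (f : ℍ → ℂ) : serre w f = serreDerivative w f := by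
  ext z
  simp [serre, qderiv_eq, Eis_two, div_eq_mul_inv]

lemma mdifferentiable_serreIter (w : ℤ) {f : ℍ → ℂ} (hf : MDiff f) (k : ℕ) :
    MDiff (serreIter w k f) := by
  induction k with
  | zero => exact hf
  | succ k ih => rw [serreIter, serre_eq]; exact serreDerivative_mdifferentiable _ ih

lemma serreIter_add (w : ℤ) {f g : ℍ → ℂ} (hf : MDiff f) (hg : MDiff g) (k : ℕ) :
    serreIter w k (f + g) = serreIter w k f + serreIter w k g := by
  induction k with
  | zero => rfl
  | succ k ih =>
    simp only [serreIter, serre_eq, ih]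
    exact serreDerivative_add _ _ _ (mdifferentiable_serreIter w hf k)
      (mdifferentiable_serreIter w hg k)

lemma serreIter_smul (w : ℤ) (c : ℂ) {f : ℍ → ℂ} (hf : MDiff f) (k : ℕ) :
    serreIter w k (c • f) = c • serreIter w k f := by
  induction k with
  | zero => rfl
  | succ k ih =>
    simp only [serreIter, serre_eq, ih]
    exact serreDerivative_smul _ _ _ (mdifferentiable_serreIter w hf k)

lemma mdifferentiable_sum_smul {ι : Type*} (s : Finset ι) (c : ι → ℂ) {f : ι → ℍ → ℂ}
    (hf : ∀ i, MDiff (f i)) : MDiff (∑ i ∈ s, c i • f i) :=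
  Finset.sum_induction _ (fun g : ℍ → ℂ ↦ MDiff g) (fun _ _ ha hb ↦ ha.add hb)
    mdifferentiable_const fun i _ ↦ (hf i).const_smul (c i)

lemma serreIter_sum_smul {ι : Type*} (s : Finset ι) (w : ℤ) (c : ι → ℂ) {f : ι → ℍ → ℂ}
    (hf : ∀ i, MDiff (f i)) (k : ℕ) :
    serreIter w k (∑ i ∈ s, c i • f i) = ∑ i ∈ s, c i • serreIter w k (f i) := by
  classical
  induction s using Finset.induction_on with
  | empty => simpa using serreIter_smul w 0 (f := 0) mdifferentiable_const k
  | insert a s ha ih =>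
    rw [Finset.sum_insert ha, Finset.sum_insert ha, ← ih, ← serreIter_smul w _ (hf a),
      serreIter_add w ((hf a).const_smul _) (mdifferentiable_sum_smul s c hf)]

/-- The sum of the roots of the indicial equation. -/
lemma sum_roots_of_indicial (w : ℤ) (r : ℕ) (b : ℕ → ℂ) (lam : Fin (r + 1) → ℕ)
    (hind : ∀ x : ℂ,
      (∏ i ∈ Finset.range (r + 1), (x - ((w : ℂ) - r + 2 * i) / 12)) +
        ∑ j ∈ Finset.Icc 2 (r + 1), b j *
          ∏ i ∈ Finset.range (r + 1 - j), (x - ((w : ℂ) - r + 2 * i) / 12)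
      = ∏ k : Fin (r + 1), (x - (lam k : ℂ))) :
    ∑ i ∈ Finset.range (r + 1), ((w : ℂ) - r + 2 * i) / 12 = ∑ k, (lam k : ℂ) := by
  have hpoly : (∏ i ∈ Finset.range (r + 1), (.X - .C (((w : ℂ) - r + 2 * i) / 12))) +
        ∑ j ∈ Finset.Icc 2 (r + 1), .C (b j) *
          ∏ i ∈ Finset.range (r + 1 - j), (.X - .C (((w : ℂ) - r + 2 * i) / 12))
      = ∏ k : Fin (r + 1), (.X - .C (lam k : ℂ) : Polynomial ℂ) := by
    refine Polynomial.funext fun x ↦ ?_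
    simpa [Polynomial.eval_prod, Polynomial.eval_finsetSum] using hind x
  have hcoeff := congrArg (Polynomial.coeff · r) hpoly
  simp only [Polynomial.coeff_add, Polynomial.finsetSum_coeff, Polynomial.coeff_C_mul] at hcoeff
  have h1 := Polynomial.prod_X_sub_C_coeff_card_pred (Finset.range (r + 1))
    (fun i : ℕ ↦ ((w : ℂ) - r + 2 * i) / 12) (by simp)
  have h2 := Polynomial.prod_X_sub_C_coeff_card_pred (Finset.univ : Finset (Fin (r + 1)))
    (fun k ↦ (lam k : ℂ)) (by simp)
  simp only [Finset.card_range, Finset.card_univ, Fintype.card_fin, Nat.add_sub_cancel] at h1 h2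
  have h3 : ∑ j ∈ Finset.Icc 2 (r + 1), b j * (∏ i ∈ Finset.range (r + 1 - j),
      (.X - .C (((w : ℂ) - r + 2 * i) / 12)) : Polynomial ℂ).coeff r = 0 := by
    refine Finset.sum_eq_zero fun j hj ↦ ?_
    rw [Polynomial.coeff_eq_zero_of_natDegree_lt, mul_zero]
    rw [Polynomial.natDegree_prod_of_monic _ _ fun i _ ↦ Polynomial.monic_X_sub_C _]
    simp only [Polynomial.natDegree_X_sub_C, Finset.sum_const, Finset.card_range, smul_eq_mul]
    grind
  rwa [h1, h2, h3, add_zero, neg_inj] at hcoeff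

lemma sum_weights (w : ℤ) (r : ℕ) :
    ∑ i ∈ Finset.range (r + 1), ((w : ℂ) - r + 2 * i) / 12 = (w * (r + 1)) / 12 := by
  have h : (∑ i ∈ Finset.range (r + 1), (i : ℂ)) * 2 = (r + 1) * r := by
    have := Finset.sum_range_id_mul_two (r + 1)
    rw [Nat.add_sub_cancel] at this
    simpa using congrArg (Nat.cast : ℕ → ℂ) this
  rw [← Finset.sum_div, Finset.sum_add_distrib, ← Finset.mul_sum]
  simp only [Finset.sum_const, Finset.card_range, nsmul_eq_mul]
  push_cast
  linear_combination h / 12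

lemma analyticAt_comp_ofComplex {f : ℍ → ℂ} (hf : MDiff f) (z : ℍ) :
    AnalyticAt ℂ (f ∘ ofComplex) z :=
  (UpperHalfPlane.mdifferentiable_iff.mp hf).analyticAt
    (isOpen_upperHalfPlaneSet.mem_nhds z.im_pos)

lemma deriv_comp_ofComplex (f : ℍ → ℂ) (z : ℍ) :
    deriv (f ∘ ofComplex) z = 2 * π * Complex.I * D f z := by
  rw [normalizedDerivOfComplex, mul_inv_cancel_left₀ Complex.two_pi_I_ne_zero]

/-- A holomorphic function on `ℍ` that vanishes near a point is zero. -/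
lemma eq_zero_of_eventually_eq_zero {f : ℍ → ℂ} (hf : MDiff f) {z : ℍ}
    (h : ∀ᶠ t in 𝓝 (z : ℂ), (f ∘ ofComplex) t = 0) : f = 0 := by
  have hana : AnalyticOnNhd ℂ (f ∘ ofComplex) upperHalfPlaneSet :=
    (UpperHalfPlane.mdifferentiable_iff.mp hf).analyticOnNhd isOpen_upperHalfPlaneSet
  have := hana.eqOn_zero_of_preconnected_of_eventuallyEq_zero
    (convex_halfSpace_im_gt 0).isPreconnected z.im_pos h
  ext τ
  simpa [ofComplex_apply] using this τ.im_pos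

/-- The coefficient matrix of the first order system satisfied by the vector of iterated Serre
derivatives of a solution of the modular differential equation. -/
noncomputable def coeffMatrix (w : ℤ) (r : ℕ) (B : ℕ → ℍ → ℂ) (z : ℍ) :
    Matrix (Fin (r + 1)) (Fin (r + 1)) ℂ :=
  .of fun i j ↦ (if (i : ℕ) = j + 1 then 1 else 0) +
    (if i = j then ((w : ℂ) - r + 2 * (j : ℕ)) / 12 * Eis 2 z else 0) -
    (if (j : ℕ) = r ∧ (i : ℕ) < r then B (r + 1 - i) z else 0)

lemma trace_coeffMatrix (w : ℤ) (r : ℕ) (B : ℕ → ℍ → ℂ) (z : ℍ) :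
    (coeffMatrix w r B z).trace = w * (r + 1) / 12 * Eis 2 z := by
  rw [← sum_weights, Finset.sum_range, Finset.sum_mul, Matrix.trace]
  refine Finset.sum_congr rfl fun j _ ↦ ?_
  simp only [coeffMatrix, Matrix.diag_apply, Matrix.of_apply]
  rw [if_neg (by lia), if_pos trivial, if_neg (by lia)]
  ring

lemma mdifferentiable_coeffMatrix (w : ℤ) (r : ℕ) {B : ℕ → ℍ → ℂ}
    (hB : ∀ j, 2 ≤ j → j ≤ r + 1 → MDiff (B j)) (i j : Fin (r + 1)) :
    MDiff (fun z ↦ coeffMatrix w r B z i j) := by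
  simp only [coeffMatrix, Matrix.of_apply]
  refine (mdifferentiable_const.add ?_).sub ?_
  · split_ifs
    · rw [Eis_two]
      exact mdifferentiable_const.mul E2_mdifferentiable
    · exact mdifferentiable_const
  · split_ifs with h
    · exact hB _ (by lia) (by lia)
    · exact mdifferentiable_const

lemma normalizedDeriv_serreIter (w : ℤ) (k : ℕ) (g : ℍ → ℂ) (z : ℍ) :
    D (serreIter w k g) z =
      serreIter w (k + 1) g z + ((w : ℂ) + 2 * k) / 12 * Eis 2 z * serreIter w k g z := by
  simp only [serreIter, serre, qderiv_eq]
  push_cast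
  ring

lemma normalizedDeriv_serreIter_of_solution {w : ℤ} {r : ℕ} {B : ℕ → ℍ → ℂ} {g : ℍ → ℂ} {z : ℍ}
    (hg : serreIter (w - r) (r + 1) g z +
        ∑ j ∈ Finset.Icc 2 (r + 1), B j z * serreIter (w - r) (r + 1 - j) g z = 0)
    (j : Fin (r + 1)) :
    D (serreIter (w - r) j g) z =
      ∑ i : Fin (r + 1), coeffMatrix w r B z i j * serreIter (w - r) i g z := by
  rw [normalizedDeriv_serreIter]
  simp only [coeffMatrix, Matrix.of_apply, sub_mul, add_mul, ite_mul, one_mul, zero_mul,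
    Finset.sum_sub_distrib, Finset.sum_add_distrib, Finset.sum_ite_eq', Finset.mem_univ, if_true]
  push_cast
  rcases (Nat.lt_succ_iff.mp j.2).lt_or_eq with hj | hj
  · have h1 : ∑ i : Fin (r + 1), (if (i : ℕ) = j + 1 then serreIter (w - r) i g z else 0) =
        serreIter (w - r) (j + 1) g z := by
      rw [Finset.sum_eq_single ⟨j + 1, by lia⟩ (fun i _ hi ↦ if_neg fun h ↦ hi (Fin.ext h))
        (by simp)]
      simp
    have h2 : ∑ i : Fin (r + 1), (if (j : ℕ) = r ∧ (i : ℕ) < r then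
        B (r + 1 - i) z * serreIter (w - r) i g z else 0) = 0 :=
      Finset.sum_eq_zero fun i _ ↦ if_neg (by lia)
    rw [h1, h2, sub_zero]
  · have h1 : ∑ i : Fin (r + 1), (if (i : ℕ) = j + 1 then serreIter (w - r) i g z else 0) = 0 :=
      Finset.sum_eq_zero fun i _ ↦ if_neg (by lia)
    have h2 : ∑ i : Fin (r + 1), (if (j : ℕ) = r ∧ (i : ℕ) < r then
        B (r + 1 - i) z * serreIter (w - r) i g z else 0) =
        ∑ j ∈ Finset.Icc 2 (r + 1), B j z * serreIter (w - r) (r + 1 - j) g z := by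
      rw [← Finset.sum_range (fun i ↦ if (j : ℕ) = r ∧ i < r then
        B (r + 1 - i) z * serreIter (w - r) i g z else 0), Finset.sum_range_succ,
        if_neg (by lia), add_zero]
      refine Finset.sum_nbij' (fun i ↦ r + 1 - i) (fun i ↦ r + 1 - i) ?_ ?_ ?_ ?_ ?_
      · grind
      · grind
      · grind
      · grind
      · intro i hi
        rw [Finset.mem_range] at hi
        rw [if_pos ⟨hj, hi⟩, show r + 1 - (r + 1 - i) = i by lia]
    rw [h1, h2, hj]
    linear_combination hg

lemma deriv_serreIter_comp_ofComplex {w : ℤ} {r : ℕ} {B : ℕ → ℍ → ℂ} {g : ℍ → ℂ}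
    {z : ℍ} (hg : serreIter (w - r) (r + 1) g z +
        ∑ j ∈ Finset.Icc 2 (r + 1), B j z * serreIter (w - r) (r + 1 - j) g z = 0)
    (j : Fin (r + 1)) :
    deriv (serreIter (w - r) j g ∘ ofComplex) z = ∑ i : Fin (r + 1),
      ((2 * π * Complex.I) • coeffMatrix w r B z) i j * serreIter (w - r) i g z := by
  rw [deriv_comp_ofComplex, normalizedDeriv_serreIter_of_solution hg, Finset.mul_sum]
  simp [mul_assoc]

/-- A solution whose iterated Serre derivatives of order at most `r` vanish at a point is zero. -/
lemma eq_zero_of_serreIter_eq_zero {w : ℤ} {r : ℕ} {B : ℕ → ℍ → ℂ}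
    (hB : ∀ j, 2 ≤ j → j ≤ r + 1 → MDiff (B j)) {g : ℍ → ℂ} (hg : MDiff g)
    (hsol : ∀ z, serreIter (w - r) (r + 1) g z +
        ∑ j ∈ Finset.Icc 2 (r + 1), B j z * serreIter (w - r) (r + 1 - j) g z = 0)
    {z : ℍ} (hz : ∀ j : Fin (r + 1), serreIter (w - r) j g z = 0) : g = 0 := by
  refine eq_zero_of_eventually_eq_zero hg (z := z) ?_
  refine eventually_eq_zero_of_linear_system
    (v := fun j : Fin (r + 1) ↦ serreIter (w - r) j g ∘ ofComplex)
    (A := fun i j ↦ (fun τ ↦ (2 * π * Complex.I) * coeffMatrix w r B τ i j) ∘ ofComplex)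
    (fun j ↦ analyticAt_comp_ofComplex (mdifferentiable_serreIter _ hg _) z)
    (fun i j ↦ analyticAt_comp_ofComplex
      (mdifferentiable_const.mul (mdifferentiable_coeffMatrix w r hB i j)) z)
    (fun j ↦ ?_) (fun j ↦ by simpa [ofComplex_apply] using hz j) 0
  filter_upwards [isOpen_upperHalfPlaneSet.mem_nhds z.im_pos] with t ht
  lift t to ℍ using ht
  rw [deriv_serreIter_comp_ofComplex (hsol t)]
  simp [ofComplex_apply]

/-- The modular Wronskian of linearly independent solutions vanishes nowhere. -/
lemma modularWronskian_ne_zero {w : ℤ} {r : ℕ} {B : ℕ → ℍ → ℂ}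
    (hB : ∀ j, 2 ≤ j → j ≤ r + 1 → MDiff (B j)) {f : Fin (r + 1) → ℍ → ℂ}
    (hf : ∀ k, MDiff (f k))
    (hsol : ∀ k z, serreIter (w - r) (r + 1) (f k) z +
        ∑ j ∈ Finset.Icc 2 (r + 1), B j z * serreIter (w - r) (r + 1 - j) (f k) z = 0)
    (hli : LinearIndependent ℂ f) (z : ℍ) : modularWronskian w r f z ≠ 0 := by
  intro h0
  obtain ⟨c, hc, hcz⟩ := Matrix.exists_vecMul_eq_zero_iff.mpr h0
  refine hc (funext (Fintype.linearIndependent_iff.mp hli c ?_))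
  refine eq_zero_of_serreIter_eq_zero hB (mdifferentiable_sum_smul _ c hf) (w := w) (z := z)
    (fun τ ↦ ?_) fun j ↦ ?_
  · simp only [serreIter_sum_smul _ _ c hf, Finset.sum_apply, Pi.smul_apply, smul_eq_mul,
      Finset.mul_sum]
    rw [Finset.sum_comm, ← Finset.sum_add_distrib]
    refine Finset.sum_eq_zero fun k _ ↦ ?_
    have := congrArg (c k * ·) (hsol k τ)
    simpa only [mul_zero, mul_add, Finset.mul_sum, mul_left_comm] using this
  · simpa [serreIter_sum_smul _ _ c hf, Matrix.vecMul, dotProduct] using congrFun hcz j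

lemma hasDerivAt_modularWronskian {w : ℤ} {r : ℕ} {B : ℕ → ℍ → ℂ} {f : Fin (r + 1) → ℍ → ℂ}
    (hf : ∀ k, MDiff (f k))
    (hsol : ∀ k z, serreIter (w - r) (r + 1) (f k) z +
        ∑ j ∈ Finset.Icc 2 (r + 1), B j z * serreIter (w - r) (r + 1 - j) (f k) z = 0) (z : ℍ) :
    HasDerivAt (modularWronskian w r f ∘ ofComplex)
      (2 * π * Complex.I * (w * (r + 1) / 12) * Eis 2 z * modularWronskian w r f z) z := by
  have := hasDerivAt_det_of_linear_system
    (M := fun t ↦ .of fun k j : Fin (r + 1) ↦ serreIter (w - r) j (f k) (ofComplex t))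
    (A := (2 * π * Complex.I) • coeffMatrix w r B z) (z := z) fun k j ↦ ?_
  · simp only [Matrix.trace_smul, trace_coeffMatrix, ofComplex_apply, smul_eq_mul] at this
    convert! this using 1
    simp only [modularWronskian]
    ring
  · have h := (analyticAt_comp_ofComplex
      (mdifferentiable_serreIter (w - r) (hf k) j) z).differentiableAt.hasDerivAt
    rw [deriv_serreIter_comp_ofComplex (hsol k z)] at h
    simpa [ofComplex_apply, Function.comp_def] using h

lemma logDeriv_Disc_comp_ofComplex (z : ℍ) :
    logDeriv (Disc ∘ ofComplex) z = 2 * π * Complex.I * Eis 2 z := by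
  have heq : Disc ∘ ofComplex =ᶠ[𝓝 (z : ℂ)] fun t ↦ ModularForm.eta t ^ 24 := by
    filter_upwards [isOpen_upperHalfPlaneSet.mem_nhds z.im_pos] with t ht
    lift t to ℍ using ht
    simp [Disc_eq, ModularForm.discriminant, ofComplex_apply]
  rw [logDeriv_apply, heq.deriv_eq, heq.eq_of_nhds, ← logDeriv_apply, logDeriv_fun_pow
    (ModularForm.differentiableAt_eta_of_mem_upperHalfPlaneSet z.im_pos),
    ModularForm.logDeriv_eta_eq_E2, Eis_two]
  push_cast
  ring

lemma mdifferentiable_Disc : MDiff Disc := by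
  rw [Disc_eq]
  exact CuspForm.discriminant.holo'

lemma Disc_ne_zero (z : ℍ) : Disc z ≠ 0 := by
  rw [Disc_eq]
  exact ModularForm.discriminant_ne_zero z

end Wronskian

open Wronskian Derivative

/-- Proposition 4 of the paper: the modular Wronskian of a fundamental
system of a normalized modular differential equation whose indicial roots are
non-negative integers `λ_0 ≥ … ≥ λ_r` equals `c Δ^{w(r+1)/12}` with `c ≠ 0`. -/
theorem wronskian_of_fundamental_system (w : ℤ) (r : ℕ) (B : ℕ → ℍ → ℂ)
    (hB : ∀ j, 2 ≤ j → j ≤ r + 1 → B j ∈ Mset (2 * j))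
    (b : ℕ → ℂ)
    (hb : ∀ j, 2 ≤ j → j ≤ r + 1 →
      Filter.Tendsto (B j) UpperHalfPlane.atImInfty (nhds (b j)))
    (K : (ℍ → ℂ) → (ℍ → ℂ))
    (hK : ∀ (g : ℍ → ℂ) (z : ℍ),
      K g z = serreIter (w - r) (r + 1) g z +
        ∑ j ∈ Finset.Icc 2 (r + 1), B j z * serreIter (w - r) (r + 1 - j) g z)
    (lam : Fin (r + 1) → ℕ) (hord : ∀ i j : Fin (r + 1), i ≤ j → lam j ≤ lam i)
    (hind : ∀ x : ℂ,
      (∏ i ∈ Finset.range (r + 1), (x - ((w : ℂ) - r + 2 * i) / 12)) +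
        ∑ j ∈ Finset.Icc 2 (r + 1), b j *
          ∏ i ∈ Finset.range (r + 1 - j), (x - ((w : ℂ) - r + 2 * i) / 12)
      = ∏ k : Fin (r + 1), (x - (lam k : ℂ)))
    (f : Fin (r + 1) → ℍ → ℂ) (hfund : IsFundamentalSystem K f) :
    ∃ c : ℂ, c ≠ 0 ∧ ∀ z : ℍ,
      modularWronskian w r f z = c * Disc z ^ (w * (r + 1) / 12) := by
  obtain ⟨hf, hKf, hli, -⟩ := hfund
  have hsol : ∀ k z, serreIter (w - r) (r + 1) (f k) z +
      ∑ j ∈ Finset.Icc 2 (r + 1), B j z * serreIter (w - r) (r + 1 - j) (f k) z = 0 :=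
    fun k z ↦ by rw [← hK, hKf k, Pi.zero_apply]
  have hB' : ∀ j, 2 ≤ j → j ≤ r + 1 → MDiff (B j) := fun j h₁ h₂ ↦ by
    obtain ⟨F, hF⟩ := hB j h₁ h₂
    exact hF ▸ F.holo'
  obtain ⟨N, hN⟩ : ∃ N : ℤ, w * (r + 1) = 12 * N := by
    have h := (sum_weights w r).symm.trans (sum_roots_of_indicial w r b lam hind)
    refine ⟨∑ k, (lam k : ℤ), ?_⟩
    have : (w : ℂ) * (r + 1) = 12 * ∑ k, (lam k : ℂ) := by linear_combination 12 * h
    exact_mod_cast this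
  have hNC : (w : ℂ) * (r + 1) / 12 = N := by
    have : (w : ℂ) * (r + 1) = 12 * N := by exact_mod_cast hN
    linear_combination this / 12
  rw [show w * (r + 1) / 12 = N by lia]
  have hW := modularWronskian_ne_zero hB' hf hsol hli
  have hdiff {z : ℂ} (hz : z ∈ upperHalfPlaneSet) : DifferentiableAt ℂ (Disc ∘ ofComplex) z :=
    (analyticAt_comp_ofComplex mdifferentiable_Disc ⟨z, hz⟩).differentiableAt
  obtain ⟨c, hc, heq⟩ := (logDeriv_eqOn_iff (f := modularWronskian w r f ∘ ofComplex)
    (g := fun t ↦ (Disc ∘ ofComplex) t ^ N)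
    (fun z hz ↦ (hasDerivAt_modularWronskian hf hsol
      ⟨z, hz⟩).differentiableAt.differentiableWithinAt)
    (fun z hz ↦ ((hdiff hz).zpow (Or.inl (Disc_ne_zero _))).differentiableWithinAt)
    isOpen_upperHalfPlaneSet (convex_halfSpace_im_gt 0).isPreconnected
    (fun z _ ↦ zpow_ne_zero _ (Disc_ne_zero _)) (fun z _ ↦ hW _)).mp fun z hz ↦ by
      rw [logDeriv_fun_zpow (hdiff hz)]
      lift z to ℍ using hz
      rw [logDeriv_Disc_comp_ofComplex, logDeriv_apply,
        (hasDerivAt_modularWronskian hf hsol z).deriv, hNC, Function.comp_apply, ofComplex_apply,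
        mul_div_cancel_right₀ _ (hW z)]
      ring
  exact ⟨c, hc, fun z ↦ by simpa [ofComplex_apply] using heq z.im_pos⟩
end

section
/- Let f = ∑_{ℓ=0}^r E_2^ℓ h_ℓ be a quasimodular form of weight w and depth r (h_ℓ ∈ M_{w−2ℓ}), and let g_0 = f, g_1, …, g_r be its attached quasimodular forms. Suppose each g_ℓ has vanishing order λ_ℓ at i∞ (i.e., g_ℓ = q^{λ_ℓ}∑_{n≥0} a_ℓ(n)q^n with a_ℓ(0) ≠ 0) with λ_ℓ < dim QM_{w−2ℓ}^{r−ℓ} for each ℓ and λ_0 ≥ λ_1 ≥ … ≥ λ_r ≥ 0. Then λ_0 + λ_1 + … + λ_r ≤ w(r+1)/12. -/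
open Complex UpperHalfPlane Finset
open scoped Manifold MatrixGroups Real

/-- Iterating a perturbation `c (j+1) = (M - s j) (c j)` of a lower bidiagonal matrix `M`. -/
theorem det_ne_zero_of_bidiagonal_recurrence {K : Type*} [Field K] (r : ℕ) (μ ν s : ℕ → K)
    (c : ℕ → ℕ → K) (hc : ∀ l ≤ r, c 0 l ≠ 0)
    (hstart : ∀ l ≤ r, ν l = 0 → ∀ i < l, μ i ≠ μ l)
    (hblock : ∀ l ≤ r, ν l ≠ 0 → 0 < l ∧ μ (l - 1) = μ l)
    (hrec : ∀ j, ∀ l ≤ r, c (j + 1) l = (μ l - s j) * c j l + ν l * c j (l - 1)) :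
    (Matrix.of fun l j : Fin (r + 1) => c j l).det ≠ 0 := by
  let b : ℕ → ℕ → ℕ → K := Nat.rec c fun m bm j l => bm (j + 1) l + (s j - μ m) * bm j l
  have hb_succ (m j l) : b (m + 1) j l = b m (j + 1) l + (s j - μ m) * b m j l := rfl
  have hb_rec (m : ℕ) : ∀ j, ∀ l ≤ r,
      b m (j + 1) l = (μ l - s j) * b m j l + ν l * b m j (l - 1) := by
    induction m with
    | zero => exact hrec
    | succ m ih =>
      intro j l hl
      rw [hb_succ, hb_succ, hb_succ, ih (j + 1) l hl]
      linear_combination (s j - μ m) * ih j l hl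
  have hb (m l) (hl : l ≤ r) :
      b (m + 1) 0 l = (μ l - μ m) * b m 0 l + ν l * b m 0 (l - 1) := by
    rw [hb_succ, hb_rec m 0 l hl]; ring
  have hb_zero (m : ℕ) : ∀ l < m, l ≤ r → b m 0 l = 0 := by
    induction m with
    | zero => simp
    | succ m ih =>
      intro l hlm hl
      rw [hb m l hl]
      have h1 : (μ l - μ m) * b m 0 l = 0 := by
        rcases Nat.lt_succ_iff_lt_or_eq.mp hlm with h | rfl
        · rw [ih l h hl, mul_zero]
        · rw [sub_self, zero_mul]
      have h2 : ν l * b m 0 (l - 1) = 0 := by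
        by_cases hν : ν l = 0
        · rw [hν, zero_mul]
        · have := (hblock l hl hν).1
          rw [ih (l - 1) (by omega) (by omega), mul_zero]
      rw [h1, h2, add_zero]
  have hb_start (l : ℕ) (hl : l ≤ r) (hν : ν l = 0) : ∀ m ≤ l, b m 0 l ≠ 0 := by
    intro m
    induction m with
    | zero => exact fun _ => hc l hl
    | succ m ih =>
      intro hm
      rw [hb m l hl, hν, zero_mul, add_zero]
      exact mul_ne_zero (sub_ne_zero.mpr (hstart l hl hν m (by omega)).symm) (ih (by omega))
  have hb_diag (m : ℕ) : m ≤ r → b m 0 m ≠ 0 := by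
    induction m with
    | zero => exact fun h => hc 0 h
    | succ m ih =>
      intro hm
      by_cases hν : ν (m + 1) = 0
      · exact hb_start _ hm hν _ le_rfl
      · have h := (hblock _ hm hν).2
        rw [Nat.add_sub_cancel] at h
        rw [hb m _ hm, h, sub_self, zero_mul, zero_add]
        exact mul_ne_zero hν (ih (by omega))
  rw [Ne, ← Matrix.exists_vecMul_eq_zero_iff]
  rintro ⟨v, hv, hv0⟩
  have hvb (m : ℕ) : ∀ j, m + j ≤ r → ∑ l : Fin (r + 1), v l * b m j l = 0 := by
    induction m with
    | zero =>
      intro j hj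
      have h : ∑ l : Fin (r + 1), v l * c j l = 0 := by
        simpa [Matrix.vecMul, dotProduct] using congrFun hv0 ⟨j, by omega⟩
      exact h
    | succ m ih =>
      intro j hj
      simp only [hb_succ, mul_add, sum_add_distrib, mul_left_comm _ (s j - μ m)]
      rw [← mul_sum, ih (j + 1) (by omega), ih j (by omega), mul_zero, add_zero]
  refine hv (funext fun l => ?_)
  induction hd : r - (l : ℕ) using Nat.strong_induction_on generalizing l with
  | _ d ih =>
    have h := hvb l 0 (by omega)
    rw [sum_eq_single l] at h
    · exact (mul_eq_zero.mp h).resolve_right (hb_diag l (by omega))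
    · intro i _ hil
      rcases lt_or_gt_of_ne (Fin.val_ne_of_ne hil) with h1 | h1
      · rw [hb_zero l i h1 (by omega), mul_zero]
      · rw [ih (r - i) (by omega) i rfl]; simp
    · simp
section
open Polynomial Differential

variable {A : Type*} [CommRing A] [Differential A]

/-- The action of twelve times the Serre derivative on the polynomial `∑ hₗ Yˡ` representing the
quasimodular form `∑ hₗ E₂ˡ`. -/
noncomputable def serrePoly (E : A) (r : ℕ) (k : ℤ) (Q : A[X]) : A[X] :=
  12 * mapCoeffs Q - (k : A[X]) * (C E * Q) + 2 * (C E * X * derivative Q) + (r : A[X]) * (X * Q)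
    - X ^ 2 * derivative Q - C (E ^ 2 - 12 * E′) * derivative Q

theorem coeff_X_mul_ite {R : Type*} [Semiring R] (Q : R[X]) (n : ℕ) :
    (X * Q).coeff n = if n = 0 then 0 else Q.coeff (n - 1) := by
  cases n <;> simp

theorem coeff_X_sq_mul_derivative {R : Type*} [CommRing R] (Q : R[X]) (n : ℕ) :
    (X ^ 2 * derivative Q).coeff n = ((n : R) - 1) * if n = 0 then 0 else Q.coeff (n - 1) := by
  rcases n with _ | _ | n
  · simp
  · rw [show (0 + 1 : ℕ) = 1 from rfl, pow_two, mul_assoc, coeff_X_mul]; simp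
  · rw [coeff_X_pow_mul, coeff_derivative]
    push_cast
    simp
    ring

theorem coeff_X_mul_derivative {R : Type*} [CommRing R] (Q : R[X]) (n : ℕ) :
    (X * derivative Q).coeff n = n * Q.coeff n := by
  rcases n with _ | n
  · simp
  · rw [coeff_X_mul, coeff_derivative]; push_cast; ring

theorem coeff_serrePoly (E : A) (r : ℕ) (k : ℤ) (Q : A[X]) (n : ℕ) :
    (serrePoly E r k Q).coeff n =
      12 * (Q.coeff n)′ - ((k : A) - 2 * n) * (E * Q.coeff n)
        + ((r : A) - n + 1) * (if n = 0 then 0 else Q.coeff (n - 1))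
        - ((n : A) + 1) * ((E ^ 2 - 12 * E′) * Q.coeff (n + 1)) := by
  have h12 : (12 : A[X]) = C 12 := rfl
  have h2 : (2 : A[X]) = C 2 := rfl
  simp only [serrePoly, coeff_sub, coeff_add, h12, h2, ← C_eq_intCast, ← C_eq_natCast,
    mul_assoc (C E), coeff_C_mul, coeff_mapCoeffs, coeff_X_sq_mul_derivative,
    coeff_X_mul_derivative]
  rw [coeff_X_mul_ite, coeff_derivative]
  ring

theorem coeff_serrePoly_eq_zero {E : A} {r : ℕ} {k : ℤ} {Q : A[X]}
    (hQ : ∀ n, r < n → Q.coeff n = 0) (n : ℕ) (hn : r < n) :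
    (serrePoly E r k Q).coeff n = 0 := by
  rw [coeff_serrePoly, hQ n hn, hQ (n + 1) (by omega), if_neg (by omega)]
  rcases (Nat.succ_le_iff.mpr hn).eq_or_lt with rfl | h
  · simp
  · rw [hQ (n - 1) (by omega)]; simp

theorem mapCoeffs_taylor (E : A) (Q : A[X]) :
    mapCoeffs (taylor E Q) = taylor E (mapCoeffs Q) + C E′ * taylor E (derivative Q) := by
  induction Q using Polynomial.induction_on' with
  | add p q hp hq => simp only [map_add, hp, hq]; ring
  | monomial n a =>
    simp only [taylor_monomial, mapCoeffs_monomial, derivative_monomial, Derivation.leibniz,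
      Derivation.leibniz_pow, mapCoeffs_C, mapCoeffs_X, map_add, smul_eq_mul, nsmul_eq_mul,
      map_mul, map_natCast]
    ring

theorem derivative_taylor_eq {R : Type*} [CommRing R] (E : R) (Q : R[X]) :
    derivative (taylor E Q) = taylor E (derivative Q) := by
  simp [taylor_apply, derivative_comp]

theorem taylor_serrePoly (E : A) (r : ℕ) (k : ℤ) (Q : A[X]) :
    taylor E (serrePoly E r k Q) =
      12 * mapCoeffs (taylor E Q) - ((k : A[X]) - (r : A[X])) * (C E * taylor E Q)
        + (r : A[X]) * (X * taylor E Q) - X ^ 2 * derivative (taylor E Q) := by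
  have hcastInt (m : ℤ) : taylor E (m : A[X]) = m := by rw [← C_eq_intCast, taylor_C]
  have hnat (m : ℕ) : taylor E (m : A[X]) = m := by rw [← C_eq_natCast, taylor_C]
  have h12 : taylor E (12 : A[X]) = 12 := taylor_C _ _
  have h2 : taylor E (2 : A[X]) = 2 := taylor_C _ _
  simp only [serrePoly, map_add, map_sub, taylor_mul, taylor_pow, taylor_C, taylor_X, hcastInt, hnat,
    h12, h2, mapCoeffs_taylor, derivative_taylor_eq, map_mul, map_pow]
  rw [show (C 12 : A[X]) = 12 from rfl]
  ring

theorem coeff_taylor_serrePoly (E : A) (r : ℕ) (k : ℤ) (Q : A[X]) (n : ℕ) :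
    (taylor E (serrePoly E r k Q)).coeff n =
      12 * ((taylor E Q).coeff n)′ - ((k : A) - r) * (E * (taylor E Q).coeff n)
        + ((r : A) - n + 1) * (if n = 0 then 0 else (taylor E Q).coeff (n - 1)) := by
  have h12 : (12 : A[X]) = C 12 := rfl
  have hk : (k : A[X]) - (r : A[X]) = C ((k : A) - r) := by simp
  rw [taylor_serrePoly, hk]
  simp only [coeff_sub, coeff_add, h12, ← C_eq_natCast, coeff_C_mul, coeff_mapCoeffs,
    coeff_X_sq_mul_derivative, coeff_X_mul_ite]
  ring

theorem coeff_taylor_eq_sum {R : Type*} [CommRing R] (E : R) {r : ℕ} {Q : R[X]}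
    (hQ : ∀ n, r < n → Q.coeff n = 0) (l : ℕ) :
    (taylor E Q).coeff l =
      ∑ i ∈ range (r + 1), (i.choose l : R) * E ^ (i - l) * Q.coeff i := by
  have hdeg : Q.natDegree < r + 1 := Nat.lt_succ_iff.mpr (natDegree_le_iff_coeff_eq_zero.mpr hQ)
  conv_lhs => rw [Q.as_sum_range_C_mul_X_pow' hdeg]
  simp only [map_sum, taylor_mul, taylor_C, taylor_X_pow, finsetSum_coeff, coeff_C_mul,
    coeff_X_add_C_pow]
  exact sum_congr rfl fun i _ => by ring

theorem det_coeff_taylor {R : Type*} [CommRing R] (E : R) {r : ℕ} (Q : ℕ → R[X])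
    (hQ : ∀ j n, r < n → (Q j).coeff n = 0) :
    (Matrix.of fun l j : Fin (r + 1) => (taylor E (Q j)).coeff l).det =
      (Matrix.of fun l j : Fin (r + 1) => (Q j).coeff l).det := by
  let T : Matrix (Fin (r + 1)) (Fin (r + 1)) R :=
    Matrix.of fun l i => ((i : ℕ).choose l : R) * E ^ ((i : ℕ) - l)
  have hT : T.det = 1 := by
    rw [Matrix.det_of_isUpperTriangular]
    · simp [T]
    · intro i j hij
      have : ((j : ℕ).choose i) = 0 := Nat.choose_eq_zero_of_lt hij
      simp [T, this]
  rw [← one_mul (Matrix.det (Matrix.of fun l j : Fin (r + 1) => (Q j).coeff l)), ← hT,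
    ← Matrix.det_mul]
  congr 1
  ext l j
  simp [Matrix.mul_apply, T, coeff_taylor_eq_sum E (hQ j), Fin.sum_univ_eq_sum_range
    (fun i => (i.choose l : R) * E ^ (i - l) * (Q j).coeff i)]
end
open PowerSeries in
/-- The function `f` on the upper half plane is the sum of the power series `a` in `q`. -/
def IsQSeries (f : ℍ → ℂ) (a : ℂ⟦X⟧) : Prop :=
  ∀ z, HasSum (fun n => coeff n a * qexp z ^ n) (f z)

namespace IsQSeries

open PowerSeries Derivative

variable {f g : ℍ → ℂ} {a b : ℂ⟦X⟧}

theorem add (hf : IsQSeries f a) (hg : IsQSeries g b) : IsQSeries (f + g) (a + b) := fun z => by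
  simpa [add_mul] using (hf z).add (hg z)

theorem neg (hf : IsQSeries f a) : IsQSeries (-f) (-a) := fun z => by
  simpa using (hf z).neg

theorem const (c : ℂ) : IsQSeries (fun _ => c) (C c) := fun z => by
  convert hasSum_single (f := fun n => coeff n (C c) * qexp z ^ n) 0 fun n hn => by
    simp [coeff_C, hn]
  simp

theorem mul (hf : IsQSeries f a) (hg : IsQSeries g b) : IsQSeries (f * g) (a * b) := fun z => by
  have hfn := summable_norm_iff.mpr (hf z).summable
  have hgn := summable_norm_iff.mpr (hg z).summable
  have h := (summable_norm_sum_mul_antidiagonal_of_summable_norm hfn hgn).of_norm.hasSum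
  rw [← tsum_mul_tsum_eq_tsum_sum_antidiagonal_of_summable_norm hfn hgn, (hf z).tsum_eq,
    (hg z).tsum_eq] at h
  refine h.congr_fun fun n => ?_
  rw [coeff_mul, sum_mul]
  refine sum_congr rfl fun p hp => ?_
  rw [← mem_antidiagonal.mp hp, pow_add]
  ring

/-- The functions given by power series in `q`, paired with these series, form a subring. -/
def subring : Subring ((ℍ → ℂ) × ℂ⟦X⟧) where
  carrier := {p | IsQSeries p.1 p.2}
  mul_mem' := mul
  add_mem' := add
  neg_mem' := neg
  one_mem' := by simpa using! const 1
  zero_mem' := by simpa using! const 0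

theorem det {n : ℕ} {M : Fin n → Fin n → ℍ → ℂ} {N : Fin n → Fin n → ℂ⟦X⟧}
    (h : ∀ i j, IsQSeries (M i j) (N i j)) :
    IsQSeries (fun z => (Matrix.of fun i j => M i j z).det) (Matrix.of N).det := by
  let P : Matrix (Fin n) (Fin n) subring := Matrix.of fun i j => ⟨(M i j, N i j), h i j⟩
  have hP := P.det.2
  have h1 : (P.det : (ℍ → ℂ) × ℂ⟦X⟧).1 = fun z => (Matrix.of fun i j => M i j z).det := by
    ext z
    exact RingHom.map_det
      ((Pi.evalRingHom (fun _ : ℍ => ℂ) z).comp ((RingHom.fst _ _).comp subring.subtype)) P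
  have h2 : (P.det : (ℍ → ℂ) × ℂ⟦X⟧).2 = (Matrix.of N).det :=
    RingHom.map_det ((RingHom.snd _ _).comp subring.subtype) P
  rw [← h1, ← h2]
  exact hP

theorem hasSum_comp_ofComplex (hf : IsQSeries f a) {w : ℂ} (hw : 0 < w.im) :
    HasSum (fun n => coeff n a * exp (2 * π * Complex.I * w) ^ n) ((f ∘ ofComplex) w) := by
  simpa [qexp, ofComplex_apply_of_im_pos hw] using hf ⟨w, hw⟩

theorem summable_bound (hf : IsQSeries f a) {y : ℝ} (hy : 0 < y) :
    Summable fun n => ‖coeff n a‖ * Real.exp (-2 * π * y) ^ n := by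
  have h := (hf ⟨y * Complex.I, by simpa using hy⟩).summable.norm
  refine h.congr fun n => ?_
  rw [norm_mul, norm_pow, qexp, norm_exp]
  simp

theorem norm_term_le (a : ℂ⟦X⟧) {y : ℝ} (n : ℕ) {w : ℂ} (hw : y < w.im) :
    ‖coeff n a * exp (2 * π * Complex.I * w) ^ n‖ ≤ ‖coeff n a‖ * Real.exp (-2 * π * y) ^ n := by
  rw [norm_mul, norm_pow, norm_exp]
  gcongr
  simp
  gcongr

theorem isOpen_lt_im (y : ℝ) : IsOpen {w : ℂ | y < w.im} :=
  isOpen_lt continuous_const continuous_im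

theorem mdifferentiable (hf : IsQSeries f a) : MDiff f := by
  rw [UpperHalfPlane.mdifferentiable_iff]
  intro w (hw : 0 < w.im)
  have hd := differentiableOn_tsum_of_summable_norm (hf.summable_bound (half_pos hw))
    (fun n => (by fun_prop : Differentiable ℂ fun v => coeff n a * exp (2 * π * Complex.I * v) ^ n)
      |>.differentiableOn) (isOpen_lt_im _) (fun n v hv => norm_term_le a n hv)
  have hU := (isOpen_lt_im (w.im / 2)).mem_nhds (half_lt_self hw)
  refine ((hd.differentiableAt hU).congr_of_eventuallyEq ?_).differentiableWithinAt
  filter_upwards [hU] with v hv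
  exact (hf.hasSum_comp_ofComplex ((half_pos hw).trans hv)).tsum_eq.symm

theorem normalizedDeriv (hf : IsQSeries f a) : IsQSeries (D f) (X * d⁄dX ℂ a) := by
  intro z
  have hz := half_pos z.im_pos
  have hd := hasSum_deriv_of_summable_norm (z := z) (hf.summable_bound hz)
    (fun n => (by fun_prop : Differentiable ℂ fun v => coeff n a * exp (2 * π * Complex.I * v) ^ n)
      |>.differentiableOn) (isOpen_lt_im _) (fun n v hv => norm_term_le a n hv)
    (half_lt_self z.im_pos)
  have hU := (isOpen_lt_im (z.im / 2)).mem_nhds (half_lt_self z.im_pos)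
  have hderiv : deriv (f ∘ ofComplex) z =
      deriv (fun w => ∑' n, coeff n a * exp (2 * π * Complex.I * w) ^ n) z := by
    refine Filter.EventuallyEq.deriv_eq ?_
    filter_upwards [hU] with v hv
    exact (hf.hasSum_comp_ofComplex (hz.trans hv)).tsum_eq.symm
  rw [← hderiv] at hd
  refine (hd.mul_left (2 * π * Complex.I)⁻¹).congr_fun fun n => ?_
  have h (n : ℕ) (w : ℂ) : exp (2 * π * Complex.I * w) ^ n = exp (n * (2 * π * Complex.I) * w) := by
    rw [← exp_nat_mul]; ring_nf
  have hexp : HasDerivAt (fun w : ℂ => coeff n a * exp (2 * π * Complex.I * w) ^ n)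
      (coeff n a * (exp (n * (2 * π * Complex.I) * z) * (n * (2 * π * Complex.I)))) z := by
    simp only [h]
    simpa using (((hasDerivAt_id (z : ℂ)).const_mul (n * (2 * π * Complex.I))).cexp).const_mul (coeff n a)
  rw [hexp.deriv, qexp, h]
  have := two_pi_I_ne_zero
  rcases n with _ | n
  · simp
  · rw [coeff_succ_X_mul, PowerSeries.coeff_derivative]
    push_cast
    field_simp

theorem hasSum_qParam (hf : IsQSeries f a) (z : ℍ) :
    HasSum (fun n => coeff n a • Function.Periodic.qParam 1 z ^ n) (f z) := by
  simpa [qexp, Function.Periodic.qParam] using hf z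

theorem isBoundedAtImInfty (hf : IsQSeries f a) : IsBoundedAtImInfty f :=
  isBoundedAtImInfty_of_hasSum_qExpansion one_pos hf.hasSum_qParam

theorem periodic (hf : IsQSeries f a) : Function.Periodic (f ∘ ofComplex) (1 : ℝ) := by
  intro w
  by_cases hw : 0 < w.im
  · have hw' : 0 < (w + (1 : ℝ)).im := by simpa using hw
    refine (hf.hasSum_comp_ofComplex hw').unique ?_
    convert hf.hasSum_comp_ofComplex hw using 4 with n
    rw [ofReal_one, mul_add, exp_add, mul_one, exp_two_pi_mul_I, mul_one]
  · have hw' : ¬ 0 < (w + (1 : ℝ)).im := by simpa using hw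
    rw [Function.comp_apply, Function.comp_apply, ofComplex_apply_of_im_nonpos (not_lt.mp hw),
      ofComplex_apply_of_im_nonpos (not_lt.mp hw')]

theorem eq_qExpansion (hf : IsQSeries f a) : a = qExpansion 1 f := by
  have hb := hf.isBoundedAtImInfty
  have han := analyticAt_cuspFunction_zero one_pos hf.periodic hf.mdifferentiable hb
  have h1 := hasFPowerSeriesOnBall_cuspFunction one_pos han hf.hasSum_qParam
  have h2 := hasFPowerSeriesOnBall_cuspFunction one_pos han
    (UpperHalfPlane.hasSum_qExpansion one_pos hf.periodic hf.mdifferentiable hb)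
  ext n
  simpa using congrArg (FormalMultilinearSeries.coeff · n)
    (h1.hasFPowerSeriesAt.eq_formalMultilinearSeries h2.hasFPowerSeriesAt)

theorem unique (ha : IsQSeries f a) (hb : IsQSeries f b) : a = b :=
  ha.eq_qExpansion.trans hb.eq_qExpansion.symm

end IsQSeries
section Modularity

open Derivative EisensteinSeries ModularForm

theorem normalizedDerivOfComplex_div_denom (γ : SL(2, ℤ)) (c : ℂ) (z : ℍ) :
    D (fun z : ℍ => c * ((γ 1 0 : ℂ) / denom γ z)) z =
      -(2 * π * Complex.I)⁻¹ * c * ((γ 1 0 : ℂ) / denom γ z) ^ 2 := by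
  have hd := ((hasDerivAt_denom_zpow (γ : GL (Fin 2) ℝ) (-1) z).const_mul (c * (γ 1 0 : ℂ)))
  have heq : (fun z : ℍ => c * ((γ 1 0 : ℂ) / denom γ z)) ∘ ofComplex =ᶠ[nhds (z : ℂ)]
      fun v => c * (γ 1 0 : ℂ) * denom γ v ^ (-1 : ℤ) := by
    filter_upwards [isOpen_upperHalfPlaneSet.mem_nhds z.im_pos] with v hv
    simp [ofComplex_apply_of_im_pos hv, div_eq_mul_inv, mul_assoc]
  rw [normalizedDerivOfComplex, heq.deriv_eq, hd.deriv]
  have : (-1 - 1 : ℤ) = -2 := by norm_num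
  simp [this, zpow_neg, div_eq_mul_inv]
  norm_cast
  ring

/-- The combination `E₂² - 12 D E₂`, which is the weight four Eisenstein series. -/
noncomputable def ramanujanE4 : ℍ → ℂ := E2 ^ 2 - (12 : ℂ) • D E2

theorem ramanujanE4_slash (γ : SL(2, ℤ)) : ramanujanE4 ∣[(4 : ℤ)] γ = ramanujanE4 := by
  have hslash : E2 ∣[(2 : ℤ)] γ =
      E2 - fun z : ℍ => 6 * Complex.I / π * ((γ 1 0 : ℂ) / denom γ z) := by
    rw [E2_slash_action]
    ext z
    have := Real.pi_ne_zero
    simp only [Pi.sub_apply, Pi.smul_apply, D2, riemannZeta_two, smul_eq_mul]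
    field_simp
  have hD := normalizedDerivOfComplex_SL_slash (k := 2) E2_mdifferentiable (γ := γ)
  have hδ : MDiff (fun z : ℍ => 6 * Complex.I / π * ((γ 1 0 : ℂ) / denom γ z)) := by
    have := E2_mdifferentiable.sub (E2_mdifferentiable.slash 2 γ)
    rwa [← SL_slash, hslash, sub_sub_cancel] at this
  rw [hslash, normalizedDerivOfComplex_sub _ _ E2_mdifferentiable hδ] at hD
  have hmul := mul_slash_SL2 2 2 γ E2 E2
  rw [hslash] at hmul
  ext z
  have hDz := congrFun hD z
  have hmz := congrFun hmul z
  simp only [Pi.sub_apply, Pi.mul_apply, normalizedDerivOfComplex_div_denom] at hDz hmz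
  rw [show (2 + 2 : ℤ) = 4 from rfl] at hDz hmz
  have hsl : (ramanujanE4 ∣[(4 : ℤ)] γ) z =
      ((E2 * E2) ∣[(4 : ℤ)] γ) z - 12 * (D E2 ∣[(4 : ℤ)] γ) z := by
    simp only [SL_slash_apply, ramanujanE4, Pi.sub_apply, Pi.mul_apply, Pi.smul_apply,
      Pi.pow_apply, smul_eq_mul]
    ring
  have hE : ramanujanE4 z = E2 z ^ 2 - 12 * D E2 z := rfl
  have hinv : (2 * π * Complex.I)⁻¹ = -Complex.I / (2 * π) := by
    rw [mul_inv, inv_I]; ring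
  rw [hsl, hmz, hE]
  rw [hinv] at hDz
  push_cast at hDz
  linear_combination 12 * hDz

/-- The `E₂ˡ`-components of the iterates of twelve times the Serre derivative, starting from the
quasimodular form `∑ E₂ˡ hₗ` of weight `w` and depth `r`, with the depth kept formally at `r`. -/
noncomputable def serreComponent (w : ℤ) (r : ℕ) (h : ℕ → ℍ → ℂ) : ℕ → ℕ → ℍ → ℂ
  | 0, l => if l ≤ r then h l else 0
  | j + 1, l =>
    (12 : ℂ) • serreDerivative ((w + 2 * j - 2 * l : ℤ) : ℂ) (serreComponent w r h j l)
      + ((r : ℂ) - l + 1) • (if l = 0 then 0 else serreComponent w r h j (l - 1))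
      - ((l : ℂ) + 1) • (ramanujanE4 * serreComponent w r h j (l + 1))

theorem serreComponent_slash {w : ℤ} {r : ℕ} {h : ℕ → ℍ → ℂ}
    (hdiff : ∀ j l, MDiff (serreComponent w r h j l))
    (hh : ∀ l ≤ r, ∀ γ : SL(2, ℤ), h l ∣[w - 2 * l] γ = h l) (γ : SL(2, ℤ)) (j l : ℕ) :
    serreComponent w r h j l ∣[w + 2 * j - 2 * l] γ = serreComponent w r h j l := by
  induction j generalizing l with
  | zero =>
    rw [Nat.cast_zero, mul_zero, add_zero, serreComponent]
    split_ifs with hl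
    · exact hh l hl γ
    · exact SlashAction.zero_slash _ _
  | succ j ih =>
    have hserre := serreDerivative_slash_invariant (hdiff j l) (ih l)
    have hprev : (if l = 0 then 0 else serreComponent w r h j (l - 1))
        ∣[w + 2 * (j + 1 : ℕ) - 2 * l] γ = if l = 0 then 0 else serreComponent w r h j (l - 1) := by
      split_ifs with hl
      · exact SlashAction.zero_slash _ _
      · have := ih (l - 1)
        rwa [show w + 2 * (j : ℤ) - 2 * (l - 1 : ℕ) = w + 2 * (j + 1 : ℕ) - 2 * l by
          push_cast [Nat.one_le_iff_ne_zero.mpr hl]; ring] at this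
    have hnext := mul_slash_SL2 4 (w + 2 * j - 2 * (l + 1 : ℕ)) γ ramanujanE4
      (serreComponent w r h j (l + 1))
    rw [ramanujanE4_slash, ih (l + 1), show (4 : ℤ) + (w + 2 * j - 2 * (l + 1 : ℕ)) =
      w + 2 * (j + 1 : ℕ) - 2 * l by push_cast; ring] at hnext
    rw [show w + 2 * (j : ℤ) - 2 * l + 2 = w + 2 * (j + 1 : ℕ) - 2 * l by push_cast; ring]
      at hserre
    rw [serreComponent, sub_eq_add_neg (G := ℍ → ℂ), SlashAction.add_slash, SlashAction.add_slash,
      SlashAction.neg_slash, SL_smul_slash, SL_smul_slash, SL_smul_slash, hserre, hprev, hnext]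

theorem apply_smul_of_slash_eq {f : ℍ → ℂ} {k : ℤ} {γ : SL(2, ℤ)} (hf : f ∣[k] γ = f) (z : ℍ) :
    f (γ • z) = denom γ z ^ k * f z := by
  have := congrFun hf z
  rw [SL_slash_apply] at this
  rw [← this, mul_left_comm, ← zpow_add₀ (denom_ne_zero _ z), add_neg_cancel, zpow_zero, mul_one]

theorem slash_eq_of_apply_smul {f : ℍ → ℂ} {k : ℤ} {γ : SL(2, ℤ)}
    (hf : ∀ z, f (γ • z) = denom γ z ^ k * f z) : f ∣[k] γ = f := by
  ext z
  rw [SL_slash_apply, hf, mul_right_comm, ← zpow_add₀ (denom_ne_zero _ z), add_neg_cancel,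
    zpow_zero, one_mul]

/-- A determinant of slash invariant functions whose weights are `u j - v l` is slash invariant. -/
theorem det_slash {n : ℕ} {M : Fin n → Fin n → ℍ → ℂ} {u v : Fin n → ℤ} {γ : SL(2, ℤ)}
    (hM : ∀ l j, M l j ∣[u j - v l] γ = M l j) :
    (fun z => (Matrix.of fun l j => M l j z).det) ∣[∑ j, u j - ∑ l, v l] γ =
      fun z => (Matrix.of fun l j => M l j z).det := by
  refine slash_eq_of_apply_smul fun z => ?_
  have hd : denom γ z ≠ 0 := denom_ne_zero _ z
  have hentry : (Matrix.of fun l j => M l j (γ • z)) = Matrix.of fun l j =>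
      denom γ z ^ u j * (Matrix.of fun l j => denom γ z ^ (-v l) * M l j z) l j := by
    ext l j
    rw [Matrix.of_apply, Matrix.of_apply, Matrix.of_apply, apply_smul_of_slash_eq (hM l j),
      sub_eq_add_neg, zpow_add₀ hd, mul_assoc]
  have hprod (s : Fin n → ℤ) : ∏ i, denom γ z ^ s i = denom γ z ^ ∑ i, s i := by
    induction (univ : Finset (Fin n)) using Finset.cons_induction with
    | empty => simp
    | cons a t ha ih => rw [prod_cons, sum_cons, ih, zpow_add₀ hd]
  have hcol := Matrix.det_mul_column (fun l => denom γ z ^ (-v l)) (Matrix.of fun l j => M l j z)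
  simp only [Matrix.of_apply] at hcol
  rw [hentry, Matrix.det_mul_row, hcol, hprod, hprod, ← mul_assoc, ← zpow_add₀ hd, sum_neg_distrib,
    ← sub_eq_add_neg]

end Modularity
section PowerSeriesWronskian

open PowerSeries Differential
open scoped Polynomial

/-- A ring equipped with a derivation is a differential ring. -/
@[reducible] def differentialOfDerivation {R A : Type*} [CommRing R] [CommRing A] [Algebra R A]
    (d : Derivation R A A) : Differential A :=
  ⟨d.restrictScalars ℤ⟩

/-- The Euler operator `X d/dX` on power series. -/
noncomputable instance eulerDifferential : Differential ℂ⟦X⟧ :=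
  differentialOfDerivation ((X : ℂ⟦X⟧) • d⁄dX ℂ)

theorem euler_eq (a : ℂ⟦X⟧) : a′ = X * d⁄dX ℂ a := rfl

theorem coeff_euler (a : ℂ⟦X⟧) (n : ℕ) : coeff n a′ = n * coeff n a := by
  rw [euler_eq]
  cases n with
  | zero => simp
  | succ n => rw [coeff_succ_X_mul, coeff_derivative]; push_cast; ring

theorem coeff_mul_of_X_pow_dvd {n : ℕ} {E a : ℂ⟦X⟧} (hE : constantCoeff E = 1) (ha : X ^ n ∣ a) :
    coeff n (E * a) = coeff n a := by
  obtain ⟨u, rfl⟩ := ha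
  rw [mul_left_comm, coeff_X_pow_mul', coeff_X_pow_mul']
  simp [hE]

/-- A Wronskian type determinant of power series has the expected vanishing order. -/
theorem X_pow_dvd_det_and_det_ne_zero (r : ℕ) (lam : ℕ → ℕ) (E : ℂ⟦X⟧) (k : ℕ → ℤ)
    (P : ℕ → ℕ → ℂ⟦X⟧) (hE : constantCoeff E = 1)
    (hmono : ∀ i j, i ≤ j → j ≤ r → lam j ≤ lam i)
    (hdvd : ∀ l ≤ r, X ^ lam l ∣ P 0 l) (hlead : ∀ l ≤ r, coeff (lam l) (P 0 l) ≠ 0)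
    (hrec : ∀ j l, P (j + 1) l = 12 * (P j l)′ - ((k j : ℂ⟦X⟧) - (r : ℂ⟦X⟧)) * (E * P j l)
      + ((r : ℂ⟦X⟧) - (l : ℂ⟦X⟧) + 1) * (if l = 0 then 0 else P j (l - 1))) :
    X ^ (∑ l ∈ range (r + 1), lam l) ∣ (Matrix.of fun l j : Fin (r + 1) => P j l).det ∧
      (Matrix.of fun l j : Fin (r + 1) => P j l).det ≠ 0 := by
  have hcoeff (j l m : ℕ) : coeff m (P (j + 1) l) = 12 * (m * coeff m (P j l))
      - ((k j : ℂ) - r) * coeff m (E * P j l)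
      + ((r : ℂ) - l + 1) * (if l = 0 then 0 else coeff m (P j (l - 1))) := by
    have h12 : (12 : ℂ⟦X⟧) = C 12 := rfl
    have hk : (k j : ℂ⟦X⟧) - (r : ℂ⟦X⟧) = C ((k j : ℂ) - r) := by simp
    have hl : (r : ℂ⟦X⟧) - (l : ℂ⟦X⟧) + 1 = C ((r : ℂ) - l + 1) := by simp
    rw [hrec, h12, hk, hl, map_add, map_sub, coeff_C_mul, coeff_C_mul, coeff_C_mul, coeff_euler]
    split_ifs <;> simp
  have hP (j : ℕ) : ∀ l ≤ r, X ^ lam l ∣ P j l := by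
    induction j with
    | zero => exact hdvd
    | succ j ih =>
      intro l hl
      rw [X_pow_dvd_iff]
      intro m hm
      rw [hcoeff, X_pow_dvd_iff.mp (ih l hl) m hm,
        X_pow_dvd_iff.mp ((ih l hl).mul_left E) m hm]
      split_ifs with h0
      · simp
      · rw [X_pow_dvd_iff.mp (ih (l - 1) (by omega)) m
          (hm.trans_le (hmono _ _ (by omega) hl))]
        simp
  choose! b hb using hP
  have hc (j l : ℕ) (hl : l ≤ r) : constantCoeff (b j l) = coeff (lam l) (P j l) := by
    rw [hb j l hl, coeff_X_pow_mul']; simp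
  have hdet : (Matrix.of fun l j : Fin (r + 1) => P j l).det =
      X ^ (∑ l ∈ range (r + 1), lam l) * (Matrix.of fun l j : Fin (r + 1) => b j l).det := by
    have := Matrix.det_mul_column (fun l : Fin (r + 1) => (X : ℂ⟦X⟧) ^ lam l)
      (Matrix.of fun l j : Fin (r + 1) => b j l)
    rw [prod_pow_eq_pow_sum, Fin.sum_univ_eq_sum_range] at this
    rw [← this]
    congr 1
    refine Matrix.ext fun l j => ?_
    exact hb j l (by omega)
  have hne : (Matrix.of fun l j : Fin (r + 1) => coeff (lam l) (P j l)).det ≠ 0 := by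
    refine det_ne_zero_of_bidiagonal_recurrence r (fun l => 12 * (lam l : ℂ))
      (fun l => if l ≠ 0 ∧ lam (l - 1) = lam l then (r : ℂ) - l + 1 else 0)
      (fun j => (k j : ℂ) - r) (fun j l => coeff (lam l) (P j l)) hlead ?_ ?_ ?_
    · intro l hl hν i hi
      have hrl : (r : ℂ) - l + 1 ≠ 0 := by
        rw [← Nat.cast_sub hl]; exact Nat.cast_add_one_ne_zero _
      have h1 : lam (l - 1) ≠ lam l := fun h => hrl (by simpa [h, show l ≠ 0 by omega] using hν)
      have h2 := hmono (l - 1) l (by omega) hl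
      have h3 := hmono i (l - 1) (by omega) (by omega)
      have h4 : lam i ≠ lam l := by omega
      simpa using h4
    · intro l _ hν
      have h : l ≠ 0 ∧ lam (l - 1) = lam l := by
        by_contra h
        exact hν (if_neg h)
      exact ⟨Nat.pos_of_ne_zero h.1, by rw [h.2]⟩
    · intro j l hl
      rw [hcoeff, coeff_mul_of_X_pow_dvd hE ⟨_, hb j l hl⟩]
      by_cases h0 : l = 0
      · simp [h0]; ring
      · by_cases h1 : lam (l - 1) = lam l
        · simp [h0, h1]; ring
        · have h2 := hmono (l - 1) l (by omega) hl
          rw [X_pow_dvd_iff.mp ⟨_, hb j (l - 1) (by omega)⟩ (lam l) (by omega)]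
          simp [h1]; ring
  refine ⟨hdet ▸ dvd_mul_right _ _, ?_⟩
  rw [hdet]
  refine mul_ne_zero (pow_ne_zero _ X_ne_zero) fun h0 => hne ?_
  have := RingHom.map_det (constantCoeff (R := ℂ)) (Matrix.of fun l j : Fin (r + 1) => b j l)
  rw [h0, map_zero] at this
  rw [this]
  congr 1
  ext l j
  exact (hc j l (by omega)).symm

/-- The polynomials in `E₂` representing the iterates of twelve times the Serre derivative. -/
noncomputable def serrePolyIter (w : ℤ) (r : ℕ) (E : ℂ⟦X⟧) (a : ℕ → ℂ⟦X⟧) : ℕ → ℂ⟦X⟧[X]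
  | 0 => ∑ l ∈ range (r + 1), Polynomial.monomial l (a l)
  | j + 1 => serrePoly E r (w + 2 * j) (serrePolyIter w r E a j)

theorem coeff_serrePolyIter_zero (w : ℤ) (r : ℕ) (E : ℂ⟦X⟧) (a : ℕ → ℂ⟦X⟧) (l : ℕ) :
    (serrePolyIter w r E a 0).coeff l = if l ≤ r then a l else 0 := by
  simp [serrePolyIter, Polynomial.finsetSum_coeff, Polynomial.coeff_monomial]

theorem coeff_serrePolyIter_eq_zero (w : ℤ) (r : ℕ) (E : ℂ⟦X⟧) (a : ℕ → ℂ⟦X⟧) (j l : ℕ)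
    (hl : r < l) : (serrePolyIter w r E a j).coeff l = 0 := by
  induction j generalizing l with
  | zero => rw [coeff_serrePolyIter_zero, if_neg (by omega)]
  | succ j ih => exact coeff_serrePoly_eq_zero ih l hl

open Derivative EisensteinSeries in
theorem isQSeries_serreComponent {w : ℤ} {r : ℕ} {h : ℕ → ℍ → ℂ} {E : ℂ⟦X⟧} {a : ℕ → ℂ⟦X⟧}
    (hE : IsQSeries E2 E) (ha : ∀ l ≤ r, IsQSeries (h l) (a l)) (j l : ℕ) :
    IsQSeries (serreComponent w r h j l) ((serrePolyIter w r E a j).coeff l) := by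
  induction j generalizing l with
  | zero =>
    rw [coeff_serrePolyIter_zero, serreComponent]
    split_ifs with hl
    · exact ha l hl
    · simpa using! IsQSeries.const 0
  | succ j ih =>
    have hprev : IsQSeries (if l = 0 then 0 else serreComponent w r h j (l - 1))
        (if l = 0 then 0 else (serrePolyIter w r E a j).coeff (l - 1)) := by
      split_ifs
      · simpa using! IsQSeries.const 0
      · exact ih (l - 1)
    have hE4 := (hE.mul hE).add ((IsQSeries.const 12).mul hE.normalizedDeriv).neg
    have key := ((((IsQSeries.const 12).mul (ih l).normalizedDeriv).add
      ((IsQSeries.const ((w + 2 * j - 2 * l : ℤ) : ℂ)).mul (hE.mul (ih l))).neg).add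
      ((IsQSeries.const ((r : ℂ) - l + 1)).mul hprev)).add
      ((IsQSeries.const ((l : ℂ) + 1)).mul (hE4.mul (ih (l + 1)))).neg
    convert key using 1
    · ext z
      simp only [serreComponent, ramanujanE4, serreDerivative, Pi.add_apply, Pi.sub_apply,
        Pi.smul_apply, Pi.mul_apply, Pi.neg_apply, Pi.pow_apply, smul_eq_mul]
      ring
    · rw [serrePolyIter, coeff_serrePoly, euler_eq, euler_eq]
      simp only [map_add, map_sub, map_natCast, map_intCast, map_one,
        show (C (12 : ℂ) : ℂ⟦X⟧) = 12 from rfl]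
      push_cast
      ring

end PowerSeriesWronskian

theorem Eis_two_eq : Eis 2 = EisensteinSeries.E2 := by
  ext z
  rw [EisensteinSeries.E2_eq_tsum_cexp, Eis, bernoulli_two, ← tsum_pnat_eq_tsum_succ
    (f := fun n => (ArithmeticFunction.sigma (2 - 1) n : ℂ) * qexp z ^ n)]
  norm_num [qexp]

section

open PowerSeries ModularForm

theorem exists_isQSeries_E2 : ∃ E : ℂ⟦X⟧, IsQSeries EisensteinSeries.E2 E ∧
    constantCoeff E = 1 :=
  ⟨mk fun m => if m = 0 then 1 else -24 * (ArithmeticFunction.sigma 1 m : ℂ), fun z => by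
    simpa [qexp] using EisensteinSeries.hasSum_qExpansion_E2 z, by simp⟩

theorem isQSeries_of_mem_Mset {w : ℤ} {f : ℍ → ℂ} (hf : f ∈ Mset w) :
    IsQSeries f (qExpansion 1 f) := by
  obtain ⟨F, rfl⟩ := hf
  intro z
  have h1 : (1 : ℝ) ∈ ((⊤ : Subgroup SL(2, ℤ)) : Subgroup (GL (Fin 2) ℝ)).strictPeriods := by
    rw [← MonoidHom.range_eq_map]
    exact one_mem_strictPeriods_SL
  simpa [qexp, Function.Periodic.qParam] using ModularForm.hasSum_qExpansion F one_pos h1 z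

theorem slash_of_mem_Mset {w : ℤ} {f : ℍ → ℂ} (hf : f ∈ Mset w) (γ : SL(2, ℤ)) :
    f ∣[w] γ = f := by
  obtain ⟨F, rfl⟩ := hf
  exact SlashInvariantForm.slash_action_eqn F _ ⟨γ, trivial, rfl⟩

theorem isQSeries_qexp_pow (n : ℕ) : IsQSeries (fun z => qexp z ^ n) (X ^ n) := fun z => by
  convert hasSum_single (f := fun m => coeff m (X ^ n : ℂ⟦X⟧) * qexp z ^ m) n fun m hm => by
    simp [coeff_X_pow, hm]
  simp

theorem HasQExpansionAt.exists_isQSeries {g : ℍ → ℂ} {n : ℕ} (hg : HasQExpansionAt g n) :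
    ∃ b : ℂ⟦X⟧, constantCoeff b ≠ 0 ∧ IsQSeries g (X ^ n * b) := by
  obtain ⟨a, ha0, ha⟩ := hg
  have hq (z : ℍ) : qexp z ^ n ≠ 0 := pow_ne_zero _ (exp_ne_zero _)
  refine ⟨mk a, by simpa using ha0, ?_⟩
  have hquot : IsQSeries (fun z => (qexp z ^ n)⁻¹ * g z) (mk a) := fun z => by
    refine ((ha z).mul_left (qexp z ^ n)⁻¹).congr_fun fun m => ?_
    rw [coeff_mk, pow_add, mul_left_comm, inv_mul_cancel_left₀ (hq z)]
  convert (isQSeries_qexp_pow n).mul hquot using 1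
  ext z
  exact (mul_inv_cancel_left₀ (hq z) _).symm

theorem gOf_eq_mul_sum (r : ℕ) (h : ℕ → ℍ → ℂ) {l : ℕ} (hl : l ≤ r) (z : ℍ) :
    gOf r h l z = ((r.choose l : ℂ))⁻¹ * (6 / ((Real.pi : ℂ) * Complex.I)) ^ l *
      ∑ i ∈ range (r + 1), (i.choose l : ℂ) * EisensteinSeries.E2 z ^ (i - l) * h i z := by
  rw [gOf, Eis_two_eq]
  congr 1
  conv_rhs => rw [show r + 1 = l + (r - l + 1) by omega, sum_range_add, sum_eq_zero (s := range l)
    (fun i hi => by simp [Nat.choose_eq_zero_of_lt (mem_range.mp hi)]), zero_add]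
  refine sum_congr rfl fun m _ => ?_
  rw [Nat.choose_symm_add, Nat.add_sub_cancel_left]

/-- Level one modular forms of weight `k` do not vanish at infinity to order above `k / 12`. -/
theorem twelve_mul_le_of_X_pow_dvd {k : ℤ} {f : ℍ → ℂ} {a : ℂ⟦X⟧} {n : ℕ}
    (hf : IsQSeries f a) (hslash : ∀ γ : SL(2, ℤ), f ∣[k] γ = f) (hdvd : X ^ n ∣ a)
    (ha : a ≠ 0) : 12 * (n : ℤ) ≤ k := by
  let F : ModularForm 𝒮ℒ k :=
    { toFun := f
      slash_action_eq' := fun _ ⟨γ, hγ⟩ => hγ ▸ hslash γ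
      holo' := hf.mdifferentiable
      bdd_at_cusps' := fun {c} hc => by
        rw [OnePoint.isBoundedAt_iff_forall_SL2Z hc]
        intro γ _
        rw [hslash γ]
        exact hf.isBoundedAtImInfty }
  have hq : qExpansion 1 F = a := hf.eq_qExpansion.symm
  have hF : F ≠ 0 := by
    intro h0
    apply ha
    rw [← hq, h0]
    exact qExpansion_zero 1
  have hk : 0 ≤ k := by
    by_contra! hk
    exact hF (DFunLike.coe_injective (ModularFormClass.levelOne_neg_weight_eq_zero hk F))
  have horder : (n : ℕ∞) ≤ ((k.toNat / 12 : ℕ) : ℕ∞) := by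
    by_contra! hlt
    refine hF (ModularForm.sturm_bound_levelOne (hlt.trans_le ?_))
    rw [hq]
    exact nat_le_order _ _ fun i hi => X_pow_dvd_iff.mp hdvd i hi
  have := Nat.cast_le.mp horder
  omega

end

/-- Proposition 6 of the paper: bound on the vanishing orders of the
forms attached to a quasimodular form of weight `w` and depth `r`:
`λ_0 + … + λ_r ≤ w(r+1)/12`. -/
theorem vanishing_orders_bound (w : ℤ) (r : ℕ) (h : ℕ → ℍ → ℂ)
    (hh : ∀ ℓ ≤ r, h ℓ ∈ Mset (w - 2 * ℓ)) (hdepth : h r ≠ 0)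
    (f : ℍ → ℂ)
    (hf : ∀ z : ℍ, f z = ∑ ℓ ∈ Finset.range (r + 1), Eis 2 z ^ ℓ * h ℓ z)
    (lam : ℕ → ℕ)
    (hq : ∀ ℓ ≤ r, HasQExpansionAt (gOf r h ℓ) (lam ℓ))
    (hlt : ∀ ℓ ≤ r, lam ℓ < dimQM (w - 2 * ℓ) (r - ℓ))
    (hmono : ∀ i j, i ≤ j → j ≤ r → lam j ≤ lam i) :
    12 * (∑ ℓ ∈ Finset.range (r + 1), (lam ℓ : ℤ)) ≤ w * (r + 1) := by
  obtain ⟨E, hE, hE1⟩ := exists_isQSeries_E2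
  let a : ℕ → PowerSeries ℂ := fun l => qExpansion 1 (h l)
  have ha (l : ℕ) (hl : l ≤ r) : IsQSeries (h l) (a l) := isQSeries_of_mem_Mset (hh l hl)
  let Q := serrePolyIter w r E a
  have hQ (j l : ℕ) (hl : r < l) : (Q j).coeff l = 0 := coeff_serrePolyIter_eq_zero w r E a j l hl
  have hH (j l : ℕ) : IsQSeries (serreComponent w r h j l) ((Q j).coeff l) :=
    isQSeries_serreComponent hE ha j l
  have hlead (l : ℕ) (hl : l ≤ r) :
      PowerSeries.X ^ lam l ∣ ((Q 0).taylor E).coeff l ∧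
        PowerSeries.coeff (lam l) (((Q 0).taylor E).coeff l) ≠ 0 := by
    obtain ⟨b, hb0, hb⟩ := (hq l hl).exists_isQSeries
    let K : ℂ := ((r.choose l : ℂ))⁻¹ * (6 / ((Real.pi : ℂ) * Complex.I)) ^ l
    have hK : K ≠ 0 := by
      have := (Nat.choose_pos hl).ne'
      have := Real.pi_ne_zero
      simp [K, *]
    have hP : IsQSeries (fun z => ∑ i ∈ range (r + 1),
        (i.choose l : ℂ) * EisensteinSeries.E2 z ^ (i - l) * h i z) (((Q 0).taylor E).coeff l) := by
      have hterm (i : ℕ) (hi : i ∈ range (r + 1)) :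
          IsQSeries ((i.choose l : ℍ → ℂ) * EisensteinSeries.E2 ^ (i - l) * h i)
            ((i.choose l : PowerSeries ℂ) * E ^ (i - l) * (Q 0).coeff i) := by
        have hi' : i ≤ r := Nat.lt_succ_iff.mp (mem_range.mp hi)
        rw [coeff_serrePolyIter_zero, if_pos hi']
        exact ((natCast_mem IsQSeries.subring (i.choose l)).mul
          (pow_mem (show (EisensteinSeries.E2, E) ∈ IsQSeries.subring from hE) (i - l))).mul (ha i hi')
      have hsum := sum_mem (S := IsQSeries.subring) (t := range (r + 1)) (f := fun i =>
        ((i.choose l : ℍ → ℂ) * EisensteinSeries.E2 ^ (i - l) * h i,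
          (i.choose l : PowerSeries ℂ) * E ^ (i - l) * (Q 0).coeff i)) hterm
      rw [coeff_taylor_eq_sum E (hQ 0)]
      convert show IsQSeries _ _ from hsum using 1
      · ext z
        simp [Prod.fst_sum]
      · simp [Prod.snd_sum]
    have heq := (((IsQSeries.const K).mul hP).unique (b := PowerSeries.X ^ lam l * b) (by
      convert hb using 1
      ext z
      exact (gOf_eq_mul_sum r h hl z).symm))
    have hP' : ((Q 0).taylor E).coeff l =
        PowerSeries.X ^ lam l * (PowerSeries.C K⁻¹ * b) := by
      rw [mul_left_comm, ← heq, ← mul_assoc, ← map_mul, inv_mul_cancel₀ hK, map_one, one_mul]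
    refine ⟨⟨_, hP'⟩, ?_⟩
    rw [hP', PowerSeries.coeff_X_pow_mul']
    simp [hK, hb0]
  obtain ⟨hdvd, hne⟩ := X_pow_dvd_det_and_det_ne_zero r lam E (fun j => w + 2 * j)
    (fun j l => ((Q j).taylor E).coeff l) hE1 hmono (fun l hl => (hlead l hl).1)
    (fun l hl => (hlead l hl).2) fun j l => coeff_taylor_serrePoly E r _ (Q j) l
  rw [det_coeff_taylor E Q hQ] at hdvd hne
  have hW := twelve_mul_le_of_X_pow_dvd
    (IsQSeries.det (M := fun l j : Fin (r + 1) => serreComponent w r h j l) fun l j => hH j l)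
    (fun γ => det_slash (u := fun j => w + 2 * (j : ℕ)) (v := fun l => 2 * (l : ℕ)) fun l j =>
      serreComponent_slash (fun j l => (hH j l).mdifferentiable)
        (fun l hl => slash_of_mem_Mset (hh l hl)) γ j l) hdvd hne
  push_cast [sum_add_distrib, add_sub_cancel_right] at hW
  simpa [mul_comm w] using hW
end
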